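/- Suppose G(H) ≅ C_p. Then the coradical H₀ is not isomorphic as a coalgebra to kC_p ⊕ M*(p−1,k)^{sp} ⊕ E, where s ≥ 1 and E is either 0 or M*(p,k)^t with t ≥ 1. -/

import Mathlib

open TensorProduct

namespace HopfClass

variable (k : Type*) [Field k]

section Wrt

variable {M : Type*} [AddCommGroup M] [Module k M]

/-- A subspace `C` is a subcoalgebra with respect to a comultiplication-like map `Δ`
if `Δ` maps `C` into the image of `C ⊗ C` in `M ⊗ M`. -/
def IsSubcoalgWrt (Δ : M →ₗ[k] M ⊗[k] M) (C : Submodule k M) : Prop :=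
  ∀ x ∈ C, Δ x ∈ LinearMap.range (TensorProduct.map C.subtype C.subtype)

/-- A simple subcoalgebra: a nonzero subcoalgebra with no nonzero proper subcoalgebras. -/
def IsSimpleSubcoalgWrt (Δ : M →ₗ[k] M ⊗[k] M) (C : Submodule k M) : Prop :=
  IsSubcoalgWrt k Δ C ∧ C ≠ ⊥ ∧
    ∀ D : Submodule k M, IsSubcoalgWrt k Δ D → D < C → D = ⊥

/-- Pointedness: every simple subcoalgebra is one-dimensional. -/
def IsPointedWrt (Δ : M →ₗ[k] M ⊗[k] M) : Prop :=
  ∀ C : Submodule k M, IsSimpleSubcoalgWrt k Δ C → Module.finrank k C = 1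

/-- Grouplike element with respect to `Δ`. -/
def IsGrouplikeWrt (Δ : M →ₗ[k] M ⊗[k] M) (g : M) : Prop :=
  g ≠ 0 ∧ Δ g = g ⊗ₜ[k] g

/-- `y` is a `(h, g)`-skew-primitive with respect to `Δ`, i.e. `Δ y = g ⊗ y + y ⊗ h`. -/
def IsSkewPrimitiveWrt (Δ : M →ₗ[k] M ⊗[k] M) (g h y : M) : Prop :=
  Δ y = g ⊗ₜ[k] y + y ⊗ₜ[k] h

/-- There are no nontrivial skew-primitive elements: every skew-primitive between grouplikes
is a scalar multiple of the difference of the grouplikes. -/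
def HasNoNontrivialSkewPrimitivesWrt (Δ : M →ₗ[k] M ⊗[k] M) : Prop :=
  ∀ g h y : M, IsGrouplikeWrt k Δ g → IsGrouplikeWrt k Δ h →
    IsSkewPrimitiveWrt k Δ g h y → ∃ c : k, y = c • (g - h)

end Wrt

section Coalg

variable (H : Type*) [AddCommGroup H] [Module k H] [Coalgebra k H]

/-- The comultiplication of a coalgebra, as a linear map. -/
noncomputable abbrev comulL : H →ₗ[k] H ⊗[k] H := CoalgebraStruct.comul

/-- The coradical of a coalgebra: the sum of all its simple subcoalgebras. -/
noncomputable def coradical : Submodule k H :=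
  sSup {C : Submodule k H | IsSimpleSubcoalgWrt k (comulL k H) C}

/-- A coalgebra is cosemisimple if it equals its coradical. -/
def IsCosemisimple : Prop := coradical k H = ⊤

/-- A coalgebra is pointed if all its simple subcoalgebras are one-dimensional. -/
def IsPointed : Prop := IsPointedWrt k (comulL k H)

/-- The set of grouplike elements. -/
def grouplikes : Set H := {g : H | IsGrouplikeWrt k (comulL k H) g}

/-- `e` is a multiplicative matrix of size `n` spanning the subspace `C`, i.e. a
linearly independent family with `Δ(e i j) = ∑ l, e i l ⊗ e l j` and `ε(e i j) = δ_ij`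
whose span is `C`; this says precisely that `C` is a simple matrix subcoalgebra
isomorphic to `M*(n,k)`, the dual of the `n × n` matrix algebra. -/
def IsMultMatrix (n : ℕ) (C : Submodule k H) (e : Fin n → Fin n → H) : Prop :=
  LinearIndependent k (fun p : Fin n × Fin n => e p.1 p.2) ∧
  C = Submodule.span k (Set.range fun p : Fin n × Fin n => e p.1 p.2) ∧
  (∀ i j, CoalgebraStruct.comul (R := k) (e i j) = ∑ l : Fin n, e i l ⊗ₜ[k] e l j) ∧
  (∀ i j, Coalgebra.counit (R := k) (e i j) = if i = j then (1 : k) else 0)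

/-- `C` is a (simple matrix) subcoalgebra isomorphic to the matrix coalgebra `M*(n,k)`. -/
def IsMatrixSubcoalg (n : ℕ) (C : Submodule k H) : Prop :=
  ∃ e : Fin n → Fin n → H, IsMultMatrix k H n C e

end Coalg

section Dual

variable (H : Type*) [Ring H] [Algebra k H] [FiniteDimensional k H]

/-- The comultiplication on the dual of a finite-dimensional algebra:
the dual map of the multiplication, composed with the canonical identification
`(H ⊗ H)* ≃ H* ⊗ H*`. -/
noncomputable def dualComul :
    Module.Dual k H →ₗ[k] Module.Dual k H ⊗[k] Module.Dual k H :=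
  (TensorProduct.dualDistribEquiv k H H).symm.toLinearMap ∘ₗ
    (LinearMap.mul' k H).dualMap

/-- A finite-dimensional Hopf algebra is copointed if its dual is pointed. -/
def IsCopointed : Prop := IsPointedWrt k (dualComul k H)

/-- The grouplike elements of the dual Hopf algebra. -/
def dualGrouplikes : Set (Module.Dual k H) :=
  {f : Module.Dual k H | IsGrouplikeWrt k (dualComul k H) f}

end Dual

section Taft

variable (p : ℕ) (q : k)

/-- `B` is (isomorphic to) the Taft Hopf algebra `T_q` of dimension `p²`: `q` is a primitive
`p`-th root of unity, `B` has dimension `p²` and is generated as an algebra by a grouplike `g`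
and a `(1,g)`-skew-primitive `x` with `g^p = 1`, `x^p = 0` and `g x = q x g`. -/
def IsTaftAlgebra (B : Type*) [Ring B] [Bialgebra k B] : Prop :=
  IsPrimitiveRoot q p ∧ Module.finrank k B = p ^ 2 ∧
  ∃ g x : B,
    IsGrouplikeWrt k (comulL k B) g ∧
    CoalgebraStruct.comul (R := k) x = x ⊗ₜ[k] (1 : B) + g ⊗ₜ[k] x ∧
    g ^ p = 1 ∧ x ^ p = 0 ∧ g * x = q • (x * g) ∧
    Algebra.adjoin k {g, x} = (⊤ : Subalgebra k B)

variable {H : Type*} [Ring H] [Bialgebra k H]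

/-- The subalgebra `T` of `H` is a sub-Hopf algebra isomorphic to the Taft algebra `T_q` of
dimension `p²`, generated by a grouplike `g` and a `(1,g)`-skew-primitive `x` satisfying the
Taft relations. -/
def IsTaftSubalgebra (T : Subalgebra k H) : Prop :=
  IsPrimitiveRoot q p ∧ Module.finrank k T = p ^ 2 ∧
  ∃ g x : H,
    IsGrouplikeWrt k (comulL k H) g ∧
    CoalgebraStruct.comul (R := k) x = x ⊗ₜ[k] (1 : H) + g ⊗ₜ[k] x ∧
    g ^ p = 1 ∧ x ^ p = 0 ∧ g * x = q • (x * g) ∧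
    Algebra.adjoin k {g, x} = T

/-- The right coinvariants `H^{co π}` of a linear map `π : H → B` on a bialgebra `H`:
elements `h` with `(id ⊗ π)(Δ h) = h ⊗ 1`. -/
def rightCoinvariants {B : Type*} [Ring B] [Bialgebra k B] (π : H →ₗ[k] B) : Set H :=
  {h : H | (TensorProduct.map LinearMap.id π) (CoalgebraStruct.comul (R := k) h)
      = h ⊗ₜ[k] (1 : B)}

end Taft

end HopfClass

namespace HopfClass

section SplitAlgebra

/-- A presentation of a finite dimensional algebra as an extension of a product of matrix algebras
by a nil ideal, together with a lift of the diagonal matrix units to orthogonal idempotents. -/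
structure SplitAlg (k A : Type*) [Field k] [Ring A] [Algebra k A] {ι : Type*} [Fintype ι]
    [DecidableEq ι] (n : ι → ℕ) where
  φ : A →ₐ[k] ∀ S, Matrix (Fin (n S)) (Fin (n S)) k
  surj : Function.Surjective φ
  nil : ∀ a, φ a = 0 → IsNilpotent a
  e : (Σ S, Fin (n S)) → A
  coi : CompleteOrthogonalIdempotents e
  φ_e : ∀ i, φ (e i) = Pi.single i.1 (Matrix.single i.2 i.2 1)

variable {k A : Type*} [Field k] [Ring A] [Algebra k A] {ι : Type*} [Fintype ι] [DecidableEq ι]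
  {n : ι → ℕ}

theorem completeOrthogonalIdempotents_single (n : ι → ℕ) :
    CompleteOrthogonalIdempotents (fun i : Σ S, Fin (n S) =>
      (Pi.single i.1 (Matrix.single i.2 i.2 1) : ∀ S, Matrix (Fin (n S)) (Fin (n S)) k)) := by
  refine ⟨⟨fun i => ?_, ?_⟩, ?_⟩
  · rw [IsIdempotentElem, ← Pi.single_mul, Matrix.single_mul_single_same, one_mul]
  · rintro ⟨S, a⟩ ⟨T, b⟩ h
    by_cases hST : S = T
    · subst hST
      have hab : a ≠ b := by rintro rfl; exact h rfl
      change Pi.single S _ * Pi.single S _ = 0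
      rw [← Pi.single_mul, Matrix.single_mul_single_of_ne _ _ _ _ hab, Pi.single_zero]
    · funext U
      by_cases hU : U = S
      · subst hU
        simp [Pi.single_eq_of_ne hST]
      · simp [Pi.single_eq_of_ne hU]
  · rw [Fintype.sum_sigma]
    funext U
    simp only [Finset.sum_apply, Pi.one_apply]
    rw [Finset.sum_eq_single U]
    · ext i j
      simp only [Pi.single_eq_same, Matrix.sum_apply, Matrix.single_apply, Matrix.one_apply]
      by_cases h : i = j
      · subst h; simp
      · rw [if_neg h, Finset.sum_eq_zero]
        rintro x -
        rw [if_neg]; rintro ⟨rfl, rfl⟩; exact h rfl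
    · intro S _ hS
      apply Finset.sum_eq_zero
      intro i _
      simp [Pi.single_eq_of_ne hS.symm]
    · simp

theorem exists_splitAlg (φ : A →ₐ[k] ∀ S, Matrix (Fin (n S)) (Fin (n S)) k)
    (surj : Function.Surjective φ) (nil : ∀ a, φ a = 0 → IsNilpotent a) :
    ∃ B : SplitAlg k A n, B.φ = φ := by
  obtain ⟨e, he, hφ⟩ := CompleteOrthogonalIdempotents.lift_of_isNilpotent_ker φ.toRingHom
    (fun x hx => nil x hx)
    (completeOrthogonalIdempotents_single n) (fun i => surj _)
  exact ⟨⟨φ, surj, nil, e, he, fun i => congrFun hφ i⟩, rfl⟩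

theorem eq_trace_of_mul_comm {d : ℕ} [NeZero d] (f : Matrix (Fin d) (Fin d) k →ₗ[k] k)
    (h : ∀ X Y, f (X * Y) = f (Y * X)) (i : Fin d) (X : Matrix (Fin d) (Fin d) k) :
    f X = f (Matrix.single i i 1) * X.trace := by
  have hdiag : ∀ a, f (Matrix.single a a 1) = f (Matrix.single i i 1) := fun a => by
    have := h (Matrix.single a i 1) (Matrix.single i a 1)
    simpa using this
  have hoff : ∀ a b, a ≠ b → f (Matrix.single a b 1) = 0 := fun a b hab => by
    have := h (Matrix.single a a 1) (Matrix.single a b 1)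
    rw [Matrix.single_mul_single_same, Matrix.single_mul_single_of_ne _ _ _ _ hab.symm, map_zero,
      one_mul] at this
    exact this
  have hs : ∀ a b, Matrix.single a b (X a b) = X a b • Matrix.single a b (1 : k) := by
    intro a b; simp
  conv_lhs => rw [Matrix.matrix_eq_sum_single X]
  simp only [map_sum, hs, map_smul, smul_eq_mul, Matrix.trace, Matrix.diag, Finset.mul_sum]
  refine Finset.sum_congr rfl fun a _ => ?_
  rw [Finset.sum_eq_single a]
  · rw [hdiag, mul_comm]
  · intro b _ hb; rw [hoff a b hb.symm, mul_zero]
  · simp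

namespace SplitAlg

variable (B : SplitAlg k A n)

theorem mul_e_self (i) : B.e i * B.e i = B.e i := B.coi.idem i

theorem exists_factor_trace [∀ S, NeZero (n S)] (τ : A →ₗ[k] k) (hτ : ∀ a b, τ (a * b) = τ (b * a))
    (hnil : ∀ a, IsNilpotent a → τ a = 0) (a : A) :
    τ a = ∑ S, τ (B.e ⟨S, 0⟩) * (B.φ a S).trace ∧
      ∀ i, τ (B.e i) = τ (B.e ⟨i.1, 0⟩) := by
  obtain ⟨g, hg⟩ := (B.φ.toLinearMap).exists_rightInverse_of_surjective
    (LinearMap.range_eq_top.2 B.surj)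
  have hg' : ∀ x, B.φ (g x) = x := fun x => LinearMap.congr_fun hg x
  have hker : ∀ a b, B.φ a = B.φ b → τ a = τ b := fun a b h => by
    rw [← sub_eq_zero, ← map_sub]
    exact hnil _ (B.nil _ (by rw [map_sub, h, sub_self]))
  have key : ∀ S (i : Fin (n S)) X, τ (g (Pi.single S X)) = τ (B.e ⟨S, i⟩) * X.trace := by
    intro S i X
    have := eq_trace_of_mul_comm (τ ∘ₗ g ∘ₗ LinearMap.single k (fun S => Matrix (Fin (n S)) (Fin (n S)) k) S) (fun X Y => by
      simp only [LinearMap.comp_apply, LinearMap.coe_single]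
      rw [hker _ (g (Pi.single S X) * g (Pi.single S Y)) (by simp [hg', Pi.single_mul]), hτ]
      exact hker _ _ (by simp [hg', Pi.single_mul])) i X
    simp only [LinearMap.comp_apply, LinearMap.coe_single] at this
    rw [this, hker (B.e ⟨S, i⟩) _ (by rw [hg', B.φ_e])]
  constructor
  · rw [hker a (g (∑ S, Pi.single S (B.φ a S))) (by
      rw [hg']; exact (Finset.univ_sum_single _).symm)]
    rw [map_sum, map_sum]
    exact Finset.sum_congr rfl fun S _ => key S 0 _
  · rintro ⟨S, i⟩
    have h1 := key S i (Matrix.single i i 1)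
    have h2 := key S 0 (Matrix.single i i 1)
    simp only [Matrix.trace_single_eq_same, mul_one] at h1 h2
    exact h1.symm.trans h2

theorem exists_multiplicity [CharZero k] [∀ S, NeZero (n S)] {M : Type*} [AddCommGroup M]
    [Module k M] [FiniteDimensional k M] (π : A →ₐ[k] Module.End k M) :
    ∃ m : ι → ℕ, (∀ i, Module.finrank k (LinearMap.range (π (B.e i))) = m i.1) ∧
      (∀ a, LinearMap.trace k M (π a) = ∑ S, (m S : k) * (B.φ a S).trace) ∧
      Module.finrank k M = ∑ S, m S * n S := by
  let τ : A →ₗ[k] k := LinearMap.trace k M ∘ₗ π.toLinearMap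
  have h := B.exists_factor_trace τ
    (fun a b => by simp only [τ, LinearMap.comp_apply, AlgHom.toLinearMap_apply, map_mul]
                   exact LinearMap.trace_mul_comm _ _ _)
    (fun a ha => (LinearMap.isNilpotent_trace_of_isNilpotent (ha.map π)).eq_zero)
  have he : ∀ i, τ (B.e i) = Module.finrank k (LinearMap.range (π (B.e i))) := fun i => by
    have : IsIdempotentElem (π (B.e i)) := (B.coi.idem i).map π
    exact (LinearMap.IsIdempotentElem.isProj_range _ this).trace
  have htr : ∀ a, LinearMap.trace k M (π a) =
      ∑ S, (Module.finrank k (LinearMap.range (π (B.e ⟨S, 0⟩))) : k) * (B.φ a S).trace := by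
    intro a
    refine ((h a).1).trans ?_
    exact Finset.sum_congr rfl fun S _ => by rw [he]
  refine ⟨fun S => Module.finrank k (LinearMap.range (π (B.e ⟨S, 0⟩))), fun i => ?_, htr, ?_⟩
  · have := (h 1).2 i
    rw [he, he] at this
    exact_mod_cast this
  · have := htr 1
    rw [map_one, LinearMap.trace_one] at this
    simp only [map_one, Pi.one_apply, Matrix.trace_one, Fintype.card_fin] at this
    exact_mod_cast this

theorem isUnit_of_φ_eq_one {z : A} (h : B.φ z = 1) : IsUnit z := by
  have := (B.nil (z - 1) (by rw [map_sub, h, map_one, sub_self])).isUnit_add_one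
  rwa [sub_add_cancel] at this

/-- A right ideal containing an element on which the idempotent `e ⟨S, a⟩` acts nontrivially has
dimension at least `n S`. -/
theorem le_finrank_of_mul_ne_zero [FiniteDimensional k A] (M : Submodule k A)
    (hM : ∀ m ∈ M, ∀ a, m * a ∈ M) {y : A} (hy : y ∈ M) (i : Σ S, Fin (n S))
    (hne : y * B.e i ≠ 0) : n i.1 ≤ Module.finrank k M := by
  obtain ⟨S, a⟩ := i
  choose u hu using fun b => B.surj (Pi.single S (Matrix.single a b 1))
  choose v hv using fun b => B.surj (Pi.single S (Matrix.single b a 1))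
  let w : Fin (n S) → A := fun b => y * B.e ⟨S, a⟩ * u b * B.e ⟨S, b⟩
  have hw : ∀ b, w b ≠ 0 := by
    intro b hb
    have hz : B.φ (B.e ⟨S, a⟩ * u b * B.e ⟨S, b⟩ * v b + (1 - B.e ⟨S, a⟩)) = 1 := by
      simp only [map_add, map_mul, map_sub, map_one, hu, hv, B.φ_e, ← Pi.single_mul,
        Matrix.single_mul_single_same, one_mul]
      abel
    apply hne
    have h1 : y * B.e ⟨S, a⟩ * (B.e ⟨S, a⟩ * u b * B.e ⟨S, b⟩ * v b + (1 - B.e ⟨S, a⟩)) = 0 := by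
      have h3 : y * B.e ⟨S, a⟩ * (1 - B.e ⟨S, a⟩) = 0 := by
        rw [mul_assoc, mul_sub, mul_one, B.mul_e_self, sub_self, mul_zero]
      have h4 : y * B.e ⟨S, a⟩ * (B.e ⟨S, a⟩ * u b * B.e ⟨S, b⟩ * v b) =
          w b * v b := by
        simp only [w, ← mul_assoc]
        rw [mul_assoc y, B.mul_e_self]
      rw [mul_add, h3, h4, hb, zero_mul, add_zero]
    exact (B.isUnit_of_φ_eq_one hz).mul_left_eq_zero.1 h1
  have hli : LinearIndependent k w := by
    rw [Fintype.linearIndependent_iff]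
    intro c hc b
    have := congrArg (· * B.e ⟨S, b⟩) hc
    simp only [Finset.sum_mul, zero_mul, smul_mul_assoc] at this
    rw [Finset.sum_eq_single b] at this
    · have h5 : w b * B.e ⟨S, b⟩ = w b := by simp only [w]; rw [mul_assoc, B.mul_e_self]
      rw [h5] at this
      exact (smul_eq_zero.1 this).resolve_right (hw b)
    · intro b' _ hb'
      simp only [w]
      rw [mul_assoc, B.coi.ortho (by simpa using hb'), mul_zero, smul_zero]
    · simp
  have hmem : ∀ b, w b ∈ M := fun b => hM _ (hM _ (hM _ hy _) _) _
  have hli' : LinearIndependent k (fun b => (⟨w b, hmem b⟩ : M)) :=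
    LinearIndependent.of_comp M.subtype hli
  simpa using hli'.fintype_card_le_finrank

theorem mem_ker_iff (a : A) : B.φ a = 0 ↔ ∀ b, IsNilpotent (a * b) := by
  refine ⟨fun h b => B.nil _ (by rw [map_mul, h, zero_mul]), fun h => ?_⟩
  funext S
  ext i j
  obtain ⟨b, hb⟩ := B.surj (Pi.single S (Matrix.single j i 1))
  have h1 := (h b).map B.φ
  have h2 : IsNilpotent ((B.φ (a * b)) S) := h1.map (Pi.evalRingHom _ S)
  have h3 := (Matrix.isNilpotent_trace_of_isNilpotent h2).eq_zero
  rw [map_mul, Pi.mul_apply, hb, Pi.single_eq_same] at h3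
  simpa [Matrix.trace_mul_single] using h3

/-- Transposed presentation of the opposite algebra. -/
def op : SplitAlg k Aᵐᵒᵖ n where
  φ := AlgHom.ofLinearMap
    ({ toFun := fun a S => (B.φ a.unop S).transpose
       map_add' := fun a b => by ext; simp
       map_smul' := fun a b => by ext; simp } :
      Aᵐᵒᵖ →ₗ[k] ∀ S, Matrix (Fin (n S)) (Fin (n S)) k)
    (by funext S; simp) (fun a b => by funext S; simp)
  surj := fun X => by
    obtain ⟨a, ha⟩ := B.surj (fun S => (X S).transpose)
    exact ⟨MulOpposite.op a, by funext S; simp [ha]⟩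
  nil := fun a ha => by
    have : IsNilpotent a.unop := B.nil _ (by
      funext S
      have := congrFun ha S
      simpa using this)
    obtain ⟨m, hm⟩ := this
    exact ⟨m, MulOpposite.unop_injective (by rw [MulOpposite.unop_pow, hm, MulOpposite.unop_zero])⟩
  e := fun i => MulOpposite.op (B.e i)
  coi := ⟨⟨fun i => by rw [IsIdempotentElem, ← MulOpposite.op_mul, B.mul_e_self],
    fun i j h => by
      change MulOpposite.op _ * MulOpposite.op _ = 0
      rw [← MulOpposite.op_mul, B.coi.ortho h.symm, MulOpposite.op_zero]⟩,
    by rw [← Finset.op_sum, B.coi.complete, MulOpposite.op_one]⟩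
  φ_e := fun i => by
    funext S
    simp only [AlgHom.ofLinearMap_apply, LinearMap.coe_mk, AddHom.coe_mk, MulOpposite.unop_op,
      B.φ_e]
    by_cases h : S = i.1
    · subst h; simp
    · simp [Pi.single_eq_of_ne h]

theorem op_φ_apply (a : Aᵐᵒᵖ) (S) : B.op.φ a S = (B.φ a.unop S).transpose := rfl

theorem op_e (i) : B.op.e i = MulOpposite.op (B.e i) := rfl

end SplitAlg

end SplitAlgebra

section Corner

variable {k A : Type*} [Field k] [Ring A] [Algebra k A] {ι : Type*} [Fintype ι] [DecidableEq ι]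
  {n : ι → ℕ}

namespace SplitAlg

variable (B : SplitAlg k A n)

/-- The kernel of the projection to the product of matrix algebras. -/
def radical : Submodule k A := LinearMap.ker B.φ.toLinearMap

theorem mem_radical {a : A} : a ∈ B.radical ↔ B.φ a = 0 := Iff.rfl

theorem mul_mem_radical_left (a : A) {y : A} (hy : y ∈ B.radical) : a * y ∈ B.radical := by
  rw [mem_radical] at *
  rw [map_mul, hy, mul_zero]

theorem mul_mem_radical_right {y : A} (hy : y ∈ B.radical) (a : A) : y * a ∈ B.radical := by
  rw [mem_radical] at *
  rw [map_mul, hy, zero_mul]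

theorem map_mem_radical (σ : A ≃ₐ[k] A) {y : A} (hy : y ∈ B.radical) : σ y ∈ B.radical := by
  rw [mem_radical, mem_ker_iff] at *
  intro b
  have := (hy (σ.symm b)).map σ
  rwa [map_mul, AlgEquiv.apply_symm_apply] at this

/-- Left multiplication on the radical. -/
noncomputable def radicalAction : A →ₐ[k] Module.End k B.radical :=
  AlgHom.ofLinearMap
    { toFun := fun a => (LinearMap.mulLeft k a).restrict
        (fun _ hy => B.mul_mem_radical_left a hy)
      map_add' := fun a b => LinearMap.ext fun y => Subtype.ext (add_mul a b (y : A))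
      map_smul' := fun c a => LinearMap.ext fun y => Subtype.ext (smul_mul_assoc c a (y : A)) }
    (LinearMap.ext fun y => Subtype.ext (one_mul (y : A)))
    (fun a b => LinearMap.ext fun y => Subtype.ext (mul_assoc a b (y : A)))

theorem radicalAction_apply (a : A) (y : B.radical) : (B.radicalAction a y : A) = a * y := rfl

theorem sum_mul_trace_e [∀ S, NeZero (n S)] (m : ι → k) (i : Σ S, Fin (n S)) :
    ∑ S, m S * (B.φ (B.e i) S).trace = m i.1 := by
  rw [Finset.sum_eq_single i.1]
  · rw [B.φ_e, Pi.single_eq_same, Matrix.trace_single_eq_same, mul_one]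
  · intro S _ hS
    rw [B.φ_e, Pi.single_eq_of_ne hS, Matrix.trace_zero, mul_zero]
  · simp

theorem trace_radicalAction_map (σ : A ≃ₐ[k] A) (a : A) :
    LinearMap.trace k B.radical (B.radicalAction (σ a)) =
      LinearMap.trace k B.radical (B.radicalAction a) := by
  let s : B.radical ≃ₗ[k] B.radical := LinearEquiv.ofSubmodules σ.toLinearEquiv _ _ (by
    ext x
    rw [Submodule.mem_map]
    constructor
    · rintro ⟨y, hy, rfl⟩; exact B.map_mem_radical σ hy
    · intro hx; exact ⟨σ.symm x, B.map_mem_radical σ.symm hx, σ.apply_symm_apply x⟩)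
  have hs : ∀ y, (s y : A) = σ y := fun y => rfl
  rw [← LinearMap.trace_conj' (B.radicalAction a) s]
  congr 1
  ext y
  obtain ⟨z, rfl⟩ := s.surjective y
  rw [LinearEquiv.conj_apply_apply, LinearEquiv.symm_apply_apply]
  simp [radicalAction_apply, hs]

/-- If the radical is small, the only nonzero Peirce components of the radical have their right
index of degree one. -/
theorem degree_one_of_corner_ne_zero [CharZero k] [FiniteDimensional k A] [∀ S, NeZero (n S)]
    (p : ℕ) (hp : 3 ≤ p) (hn : ∀ S, n S = 1 ∨ p - 1 ≤ n S)
    (hcard : (Finset.univ.filter fun S => n S = 1).card = p)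
    (htrans : ∀ i j : Σ S, Fin (n S), n i.1 = 1 → n j.1 = 1 →
      ∃ σ : A ≃ₐ[k] A, B.φ (σ (B.e i)) = B.φ (B.e j))
    (hdim : Module.finrank k B.radical = p * (p - 2)) {y : A} (hy : y ∈ B.radical)
    (i j : Σ S, Fin (n S)) (hne : B.e i * y * B.e j ≠ 0) : n j.1 = 1 := by
  by_contra hj
  replace hj := (hn j.1).resolve_left hj
  obtain ⟨m, hm, htr, hsum⟩ := B.exists_multiplicity B.radicalAction
  rw [hdim] at hsum
  have hmi : p - 1 ≤ m i.1 := by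
    refine hj.trans ?_
    rw [← hm i, ← Submodule.finrank_map_subtype_eq]
    refine B.le_finrank_of_mul_ne_zero _ ?_ (y := B.e i * y) ?_ j hne
    · rintro _ ⟨_, ⟨x, rfl⟩, rfl⟩ a
      refine ⟨_, ⟨⟨x * a, B.mul_mem_radical_right x.2 a⟩, rfl⟩, ?_⟩
      simp [radicalAction_apply, mul_assoc]
    · exact ⟨_, ⟨⟨y, hy⟩, rfl⟩, rfl⟩
  obtain ⟨r, rfl⟩ := Nat.exists_eq_add_of_le hp
  have e1 : 3 + r - 1 = r + 2 := by omega
  have e2 : 3 + r - 2 = r + 1 := by omega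
  rw [e1] at hmi hn
  rw [e2] at hsum
  rcases hn i.1 with h1 | h1
  · have hall : ∀ S, n S = 1 → r + 2 ≤ m S := by
      intro S hS
      obtain ⟨σ, hσ⟩ := htrans i ⟨S, 0⟩ h1 hS
      have h2 := B.trace_radicalAction_map σ (B.e i)
      rw [htr, htr, hσ, B.sum_mul_trace_e, B.sum_mul_trace_e] at h2
      have : m S = m i.1 := by exact_mod_cast h2
      omega
    have : ∑ S ∈ Finset.univ.filter (fun S => n S = 1), (r + 2) ≤ ∑ S, m S * n S := by
      refine (Finset.sum_le_sum (f := fun _ => r + 2) (g := fun S => m S * n S) ?_).trans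
        (Finset.sum_le_univ_sum_of_nonneg (fun _ => Nat.zero_le _))
      intro S hS
      have hS' := (Finset.mem_filter.1 hS).2
      simp only [hS', mul_one]
      exact hall S hS'
    rw [Finset.sum_const, hcard, ← hsum] at this
    simp at this
  · have : m i.1 * n i.1 ≤ ∑ S, m S * n S :=
      Finset.single_le_sum (f := fun S => m S * n S) (fun _ _ => Nat.zero_le _) (Finset.mem_univ _)
    have h3 : (r + 2) * (r + 2) ≤ m i.1 * n i.1 := Nat.mul_le_mul hmi h1
    nlinarith

theorem op_mem_radical {y : A} : MulOpposite.op y ∈ B.op.radical ↔ y ∈ B.radical := by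
  rw [mem_radical, mem_radical]
  constructor
  · intro h
    funext S
    have := congrFun h S
    rw [op_φ_apply] at this
    simpa using this
  · intro h
    funext S
    rw [op_φ_apply, MulOpposite.unop_op, h]
    simp

theorem finrank_op_radical : Module.finrank k B.op.radical = Module.finrank k B.radical := by
  have : B.op.radical = B.radical.map (MulOpposite.opLinearEquiv k : A ≃ₗ[k] Aᵐᵒᵖ).toLinearMap := by
    ext x
    rw [Submodule.mem_map]
    constructor
    · intro hx
      exact ⟨x.unop, B.op_mem_radical.1 (by simpa using hx), by simp⟩
    · rintro ⟨y, hy, rfl⟩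
      exact B.op_mem_radical.2 hy
  rw [this]
  exact LinearEquiv.finrank_map_eq _ _

theorem degree_one_of_corner_ne_zero' [CharZero k] [FiniteDimensional k A] [∀ S, NeZero (n S)]
    (p : ℕ) (hp : 3 ≤ p) (hn : ∀ S, n S = 1 ∨ p - 1 ≤ n S)
    (hcard : (Finset.univ.filter fun S => n S = 1).card = p)
    (htrans : ∀ i j : Σ S, Fin (n S), n i.1 = 1 → n j.1 = 1 →
      ∃ σ : A ≃ₐ[k] A, B.φ (σ (B.e i)) = B.φ (B.e j))
    (hdim : Module.finrank k B.radical = p * (p - 2)) {y : A} (hy : y ∈ B.radical)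
    (i j : Σ S, Fin (n S)) (hne : B.e i * y * B.e j ≠ 0) : n i.1 = 1 := by
  have : FiniteDimensional k Aᵐᵒᵖ := Module.Finite.equiv (MulOpposite.opLinearEquiv k)
  refine B.op.degree_one_of_corner_ne_zero p hp hn hcard ?_ (B.finrank_op_radical.trans hdim)
    (B.op_mem_radical.2 hy) j i ?_
  · intro i j hi hj
    obtain ⟨σ, hσ⟩ := htrans i j hi hj
    refine ⟨AlgEquiv.op σ, ?_⟩
    funext S
    rw [op_φ_apply, op_φ_apply]
    have := congrFun hσ S
    simp only [op_e, MulOpposite.unop_op]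
    exact congrArg Matrix.transpose this
  · rw [op_e, op_e, ← MulOpposite.op_mul, ← MulOpposite.op_mul, ← mul_assoc]
    exact fun h => hne (MulOpposite.op_injective h)

theorem radical_pow_eq_bot [FiniteDimensional k A] : ∃ N, B.radical ^ N = ⊥ := by
  have hle : ∀ y ∈ B.radical, y ∈ Ring.jacobson A := by
    intro y hy
    rw [Ring.jacobson_eq_sInf_isMaximal, Submodule.mem_sInf]
    intro I hI
    by_contra hyI
    obtain ⟨a, ha, b, hb, hab⟩ : ∃ a ∈ I, ∃ b ∈ Submodule.span A {y}, a + b = 1 := by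
      have : I ⊔ Submodule.span A {y} = ⊤ := by
        refine (Ideal.isMaximal_def.1 hI).2 _ (lt_of_le_of_ne le_sup_left ?_)
        intro h
        apply hyI
        rw [h]
        exact Submodule.mem_sup_right (Submodule.mem_span_singleton_self y)
      have h1 : (1 : A) ∈ I ⊔ Submodule.span A {y} := by rw [this]; trivial
      exact Submodule.mem_sup.1 h1
    obtain ⟨c, rfl⟩ := Submodule.mem_span_singleton.1 hb
    have : IsUnit a := B.isUnit_of_φ_eq_one (by
      rw [← sub_eq_iff_eq_add.2 hab.symm, map_sub, map_one, smul_eq_mul, map_mul,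
        B.mem_radical.1 hy, mul_zero, sub_zero])
    exact hI.ne_top (Ideal.eq_top_of_isUnit_mem I ha this)
  have : IsArtinianRing A := IsArtinianRing.of_finite k A
  obtain ⟨N, hN⟩ : IsNilpotent (Ring.jacobson A) := IsSemiprimaryRing.isNilpotent
  refine ⟨N, ?_⟩
  have : ∀ N, ∀ x ∈ B.radical ^ N, x ∈ Ring.jacobson A ^ N := by
    intro N
    induction N with
    | zero => intro x _; rw [Submodule.pow_zero, Ideal.one_eq_top]; trivial
    | succ N ih =>
      intro x hx
      rw [pow_succ] at hx
      rw [Submodule.pow_succ]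
      refine Submodule.mul_induction_on hx (fun a ha b hb => ?_) (fun a b ha hb => add_mem ha hb)
      exact Ideal.mul_mem_mul (ih a ha) (hle b hb)
  rw [eq_bot_iff]
  intro x hx
  have := this N x hx
  rw [hN] at this
  exact this

/-- A nonzero radical has a Peirce component not contained in its square. -/
theorem exists_corner_notMem_sq [FiniteDimensional k A] (h : B.radical ≠ ⊥) :
    ∃ y ∈ B.radical, ∃ i j, B.e i * y * B.e j ∉ B.radical * B.radical := by
  by_contra! hcon
  obtain ⟨N, hN⟩ := B.radical_pow_eq_bot
  have hle : B.radical ≤ B.radical * B.radical := by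
    intro y hy
    have : y = ∑ i, ∑ j, B.e i * y * B.e j := by
      simp only [← Finset.mul_sum, ← Finset.sum_mul, B.coi.complete, one_mul, mul_one]
    rw [this]
    exact sum_mem fun i _ => sum_mem fun j _ => hcon y hy i j
  have hpow : ∀ N, B.radical ≤ B.radical ^ (N + 1) := by
    intro N
    induction N with
    | zero => simp
    | succ N ih =>
      rw [pow_succ]
      exact hle.trans (mul_le_mul_left ih _)
  apply h
  rw [eq_bot_iff]
  refine (hpow N).trans ?_
  rw [pow_succ, hN, Submodule.bot_mul]

end SplitAlg

end Corner

section Convolution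

/-- The convolution algebra dual to a coalgebra. -/
abbrev ConvDual (k H : Type*) [Field k] [AddCommGroup H] [Module k H] : Type _ :=
  WithConv (H →ₗ[k] k)

/-- `m` is a (not necessarily linearly independent) multiplicative matrix. -/
structure IsMulMat (k : Type*) {H N : Type*} [Field k] [AddCommGroup H] [Module k H]
    [Coalgebra k H] [Fintype N] [DecidableEq N] (m : N → N → H) : Prop where
  comul : ∀ i j, CoalgebraStruct.comul (R := k) (m i j) = ∑ l, m i l ⊗ₜ[k] m l j
  counit : ∀ i j, Coalgebra.counit (R := k) (m i j) = if i = j then (1 : k) else 0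

section Coalg

variable {k H : Type*} [Field k] [AddCommGroup H] [Module k H]

/-- The value of `a ⊗ b` on a tensor. -/
noncomputable def pair (a b : ConvDual k H) : H ⊗[k] H →ₗ[k] k :=
  LinearMap.mul' k k ∘ₗ TensorProduct.map a.ofConv b.ofConv

@[simp] theorem pair_tmul (a b : ConvDual k H) (x y : H) :
    pair a b (x ⊗ₜ y) = a.ofConv x * b.ofConv y := rfl

theorem eq_of_forall_ofConv {x y : H} (h : ∀ a : ConvDual k H, a.ofConv x = a.ofConv y) :
    x = y := by
  rw [← sub_eq_zero, ← Module.forall_dual_apply_eq_zero_iff k]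
  intro f
  have := h (WithConv.toConv f)
  rw [map_sub, sub_eq_zero]
  exact this

theorem eq_of_forall_pair [FiniteDimensional k H] {z w : H ⊗[k] H}
    (h : ∀ a b : ConvDual k H, pair a b z = pair a b w) : z = w := by
  let b := Module.finBasis k H
  apply (b.tensorProduct b).ext_elem
  rintro ⟨i, j⟩
  have key : ∀ z : H ⊗[k] H, ((b.tensorProduct b).repr z) (i, j) =
      pair (WithConv.toConv (b.coord i)) (WithConv.toConv (b.coord j)) z := by
    intro z
    induction z using TensorProduct.induction_on with
    | zero => simp
    | tmul x y => simp [Module.Basis.tensorProduct_repr_tmul_apply, mul_comm]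
    | add x y hx hy => simp [hx, hy]
  rw [key, key, h]

theorem exists_ofConv_eq [FiniteDimensional k H] (θ : ConvDual k H →ₗ[k] k) :
    ∃ x : H, ∀ a, θ a = a.ofConv x := by
  obtain ⟨x, hx⟩ := (Module.evalEquiv k H).surjective
    (θ ∘ₗ (WithConv.linearEquiv k (H →ₗ[k] k)).symm.toLinearMap)
  refine ⟨x, fun a => ?_⟩
  have := LinearMap.congr_fun hx a.ofConv
  exact this.symm

instance [FiniteDimensional k H] : FiniteDimensional k (ConvDual k H) :=
  Module.Finite.equiv (WithConv.linearEquiv k (H →ₗ[k] k)).symm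

theorem finrank_convDual : Module.finrank k (ConvDual k H) = Module.finrank k H :=
  (WithConv.linearEquiv k (H →ₗ[k] k)).finrank_eq.trans Subspace.dual_finrank_eq

/-- Partial evaluation of a tensor on the left. -/
noncomputable def evalLeft (a : ConvDual k H) : H ⊗[k] H →ₗ[k] H :=
  (TensorProduct.lid k H).toLinearMap ∘ₗ TensorProduct.map a.ofConv LinearMap.id

/-- Partial evaluation of a tensor on the right. -/
noncomputable def evalRight (a : ConvDual k H) : H ⊗[k] H →ₗ[k] H :=
  (TensorProduct.rid k H).toLinearMap ∘ₗ TensorProduct.map LinearMap.id a.ofConv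

@[simp] theorem evalLeft_tmul (a : ConvDual k H) (x y : H) :
    evalLeft a (x ⊗ₜ y) = a.ofConv x • y := rfl

@[simp] theorem evalRight_tmul (a : ConvDual k H) (x y : H) :
    evalRight a (x ⊗ₜ y) = a.ofConv y • x := rfl

theorem eval_mem_of_mem_range {E : Submodule k H} {z : H ⊗[k] H}
    (hz : z ∈ LinearMap.range (TensorProduct.map E.subtype E.subtype)) (a : ConvDual k H) :
    evalLeft a z ∈ E ∧ evalRight a z ∈ E := by
  obtain ⟨w, rfl⟩ := hz
  induction w using TensorProduct.induction_on with
  | zero => simp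
  | tmul x y =>
    simp only [TensorProduct.map_tmul, Submodule.subtype_apply, evalLeft_tmul, evalRight_tmul]
    exact ⟨E.smul_mem _ y.2, E.smul_mem _ x.2⟩
  | add x y hx hy =>
    simp only [map_add]
    exact ⟨E.add_mem hx.1 hy.1, E.add_mem hx.2 hy.2⟩

variable [Coalgebra k H]

theorem ofConv_mul (a b : ConvDual k H) (x : H) :
    (a * b).ofConv x = pair a b (CoalgebraStruct.comul (R := k) x) := rfl

theorem ofConv_one (x : H) :
    (1 : ConvDual k H).ofConv x = Coalgebra.counit (R := k) x := by
  exact LinearMap.convOne_apply x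

variable {N : Type*} [Fintype N] [DecidableEq N]

/-- The representation of the dual algebra given by a multiplicative matrix. -/
noncomputable def IsMulMat.hom {m : N → N → H} (hm : IsMulMat k m) :
    ConvDual k H →ₐ[k] Matrix N N k :=
  AlgHom.ofLinearMap
    { toFun := fun a => Matrix.of fun i j => a.ofConv (m i j)
      map_add' := fun a b => rfl
      map_smul' := fun c a => rfl }
    (by
      ext i j
      change (1 : ConvDual k H).ofConv (m i j) = _
      rw [ofConv_one, hm.counit, Matrix.one_apply])
    (fun a b => by
      ext i j
      change (a * b).ofConv (m i j) = _
      rw [ofConv_mul, hm.comul, Matrix.mul_apply, map_sum]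
      rfl)

theorem IsMulMat.hom_apply {m : N → N → H} (hm : IsMulMat k m) (a : ConvDual k H) (i j : N) :
    hm.hom a i j = a.ofConv (m i j) := rfl

theorem exists_isMulMat [FiniteDimensional k H] (ψ : ConvDual k H →ₐ[k] Matrix N N k) :
    ∃ m : N → N → H, IsMulMat k m ∧ ∀ a i j, ψ a i j = a.ofConv (m i j) := by
  choose m hm using fun i j =>
    exists_ofConv_eq (LinearMap.proj j ∘ₗ LinearMap.proj i ∘ₗ ψ.toLinearMap :
      ConvDual k H →ₗ[k] k)
  replace hm : ∀ a i j, ψ a i j = a.ofConv (m i j) := fun a i j => hm i j a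
  refine ⟨m, ⟨fun i j => ?_, fun i j => ?_⟩, hm⟩
  · apply eq_of_forall_pair
    intro a b
    rw [← ofConv_mul, ← hm, map_mul, Matrix.mul_apply, map_sum]
    exact Finset.sum_congr rfl fun l _ => by rw [pair_tmul, ← hm, ← hm]
  · rw [← ofConv_one, ← hm, map_one, Matrix.one_apply]

theorem exists_isGroupLikeElem [FiniteDimensional k H] (θ : ConvDual k H →ₐ[k] k) :
    ∃ g : H, IsGroupLikeElem k g ∧ ∀ a, θ a = a.ofConv g := by
  obtain ⟨g, hg⟩ := exists_ofConv_eq θ.toLinearMap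
  replace hg : ∀ a, θ a = a.ofConv g := hg
  refine ⟨g, ⟨?_, ?_⟩, hg⟩
  · rw [← ofConv_one, ← hg, map_one]
  · apply eq_of_forall_pair
    intro a b
    rw [← ofConv_mul, ← hg, map_mul, pair_tmul, hg, hg]

theorem span_le_coradical {m : N → N → H} [Nonempty N] (hm : IsMulMat k m)
    (hsurj : Function.Surjective hm.hom) (i j : N) : m i j ∈ coradical k H := by
  set E := Submodule.span k (Set.range fun q : N × N => m q.1 q.2) with hE
  have hmem : ∀ i j, m i j ∈ E := fun i j => Submodule.subset_span ⟨(i, j), rfl⟩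
  choose u hu using fun i j => hsurj (Matrix.single i j 1)
  have hu' : ∀ i j s t, (u i j).ofConv (m s t) = if i = s ∧ j = t then 1 else 0 := by
    intro i j s t
    rw [← hm.hom_apply, hu, Matrix.single_apply]
  suffices h : IsSimpleSubcoalgWrt k (comulL k H) E from
    (le_sSup (a := E) h : E ≤ coradical k H) (hmem i j)
  have hne : ∀ i j, m i j ≠ 0 := fun i j h => by
    have := hu' i j i j
    rw [h, map_zero] at this
    simp at this
  have hsub : IsSubcoalgWrt k (comulL k H) E := by
    intro x hx
    induction hx using Submodule.span_induction with
    | mem x hx =>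
      obtain ⟨⟨i, j⟩, rfl⟩ := hx
      change CoalgebraStruct.comul (R := k) (m i j) ∈ _
      rw [hm.comul]
      exact sum_mem fun l _ => ⟨⟨m i l, hmem i l⟩ ⊗ₜ ⟨m l j, hmem l j⟩, rfl⟩
    | zero => rw [map_zero]; exact zero_mem _
    | add x y _ _ hx hy => rw [map_add]; exact add_mem hx hy
    | smul c x _ hx => rw [map_smul]; exact Submodule.smul_mem _ c hx
  refine ⟨hsub, ?_, fun D hD hlt => ?_⟩
  · intro h
    exact hne i j (by simpa [h] using hmem i j)
  · by_contra hbot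
    obtain ⟨y, hyD, hy0⟩ := D.exists_mem_ne_zero_of_ne_bot hbot
    apply hlt.not_ge
    obtain ⟨c, hc⟩ : ∃ c : N × N → k, ∑ q, c q • m q.1 q.2 = y :=
      (Submodule.mem_span_range_iff_exists_fun k).1 (hlt.le hyD)
    obtain ⟨⟨s, t⟩, hst⟩ : ∃ q, c q ≠ 0 := by
      by_contra! h0
      apply hy0
      rw [← hc]
      simp [h0]
    have hstep : ∀ v w : N, m v w ∈ D := by
      intro v w
      have h1 : evalLeft (u s v) (CoalgebraStruct.comul (R := k) y) ∈ D :=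
        (eval_mem_of_mem_range (hD y hyD) _).1
      have h2 := (eval_mem_of_mem_range (hD _ h1) (u w t)).2
      have h3 : evalLeft (u s v) (CoalgebraStruct.comul (R := k) y) = ∑ q, c (s, q) • m v q := by
        rw [← hc]
        simp only [map_sum, map_smul, hm.comul, evalLeft_tmul, hu', Fintype.sum_prod_type]
        rw [Finset.sum_eq_single s]
        · refine Finset.sum_congr rfl fun q _ => ?_
          rw [Finset.sum_eq_single v] <;> simp +contextual [eq_comm]
        · intro s' _ hs'
          simp [hs'.symm]
        · simp
      have h4 : evalRight (u w t) (CoalgebraStruct.comul (R := k)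
          (evalLeft (u s v) (CoalgebraStruct.comul (R := k) y))) = c (s, t) • m v w := by
        rw [h3]
        simp only [map_sum, map_smul, hm.comul, evalRight_tmul, hu']
        rw [Finset.sum_eq_single t]
        · rw [Finset.sum_eq_single w] <;> simp +contextual [eq_comm]
        · intro s' _ hs'
          simp [hs'.symm]
        · simp
      have h5 : c (s, t) • m v w ∈ D := h4 ▸ h2
      exact (Submodule.smul_mem_iff D hst).1 h5
    rw [hE, Submodule.span_le]
    rintro _ ⟨q, rfl⟩
    exact hstep _ _

/-- A functional vanishing on the coradical is nilpotent. -/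
theorem isNilpotent_of_forall_coradical [IsAlgClosed k] [FiniteDimensional k H]
    (a : ConvDual k H) (ha : ∀ x ∈ coradical k H, a.ofConv x = 0) : IsNilpotent a := by
  have : IsArtinianRing (ConvDual k H) := IsArtinianRing.of_finite k _
  let R := ConvDual k H ⧸ Ring.jacobson (ConvDual k H)
  have : IsSemisimpleRing R := IsSemiprimaryRing.isSemisimpleRing
  have : FiniteDimensional k R :=
    Module.Finite.of_surjective (Ideal.Quotient.mkₐ k (Ring.jacobson (ConvDual k H))).toLinearMap
      (Ideal.Quotient.mkₐ_surjective k _)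
  obtain ⟨n, d, hd, ⟨f⟩⟩ := IsSemisimpleRing.exists_algEquiv_pi_matrix_of_isAlgClosed k R
  have h0 : f (Ideal.Quotient.mkₐ k _ a) = 0 := by
    funext i
    let ψ : ConvDual k H →ₐ[k] Matrix (Fin (d i)) (Fin (d i)) k :=
      (Pi.evalAlgHom k (fun i => Matrix (Fin (d i)) (Fin (d i)) k) i).comp
        (f.toAlgHom.comp (Ideal.Quotient.mkₐ k (Ring.jacobson (ConvDual k H))))
    have hψ : Function.Surjective ψ := by
      intro X
      obtain ⟨b, hb⟩ := f.surjective (Pi.single i X)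
      obtain ⟨c, rfl⟩ := Ideal.Quotient.mkₐ_surjective k _ b
      refine ⟨c, ?_⟩
      have h := congrFun hb i
      rw [Pi.single_eq_same] at h
      exact h
    obtain ⟨m, hm, hψm⟩ := exists_isMulMat ψ
    have hhom : hm.hom = ψ := by
      ext b s t
      rw [hm.hom_apply, hψm]
    have := hd i
    have : Nonempty (Fin (d i)) := ⟨0⟩
    ext s t
    change ψ a s t = 0
    rw [hψm]
    exact ha _ (span_le_coradical hm (hhom ▸ hψ) s t)
  have h1 : a ∈ Ring.jacobson (ConvDual k H) := by
    rw [← Ideal.Quotient.eq_zero_iff_mem]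
    exact f.injective (h0.trans (map_zero f).symm)
  obtain ⟨N, hN⟩ : IsNilpotent (Ring.jacobson (ConvDual k H)) := IsSemiprimaryRing.isNilpotent
  refine ⟨N, ?_⟩
  have : a ^ N ∈ Ring.jacobson (ConvDual k H) ^ N := by
    clear hN
    induction N with
    | zero => rw [Submodule.pow_zero, Ideal.one_eq_top]; trivial
    | succ N ih =>
      rw [pow_succ, Submodule.pow_succ]
      exact Ideal.mul_mem_mul ih h1
  rw [hN] at this
  exact this

end Coalg

end Convolution

section Hopf

variable {k H : Type*} [Field k] [Ring H] [HopfAlgebra k H]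

/-- Right translation of functionals, `a ↦ a(· y)`. -/
noncomputable def rightTr (y : H) : ConvDual k H →ₗ[k] ConvDual k H where
  toFun a := WithConv.toConv (a.ofConv ∘ₗ LinearMap.mulRight k y)
  map_add' _ _ := rfl
  map_smul' _ _ := rfl

@[simp] theorem rightTr_apply (y : H) (a : ConvDual k H) (x : H) :
    (rightTr y a).ofConv x = a.ofConv (x * y) := rfl

theorem pair_mul_tmul (a b : ConvDual k H) (z : H ⊗[k] H) (u w : H) :
    pair a b (z * u ⊗ₜ w) = pair (rightTr u a) (rightTr w b) z := by
  induction z using TensorProduct.induction_on with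
  | zero => simp
  | tmul x y => simp
  | add x y hx hy => simp [add_mul, hx, hy]

theorem ext_ofConv {a b : ConvDual k H} (h : ∀ x, a.ofConv x = b.ofConv x) : a = b :=
  WithConv.ofConv_injective (LinearMap.ext h)

theorem rightTr_mul {N : Type*} [Fintype N] {y : H} {u w : N → H}
    (hy : CoalgebraStruct.comul (R := k) y = ∑ l, u l ⊗ₜ[k] w l) (a b : ConvDual k H) :
    rightTr y (a * b) = ∑ l, rightTr (u l) a * rightTr (w l) b := by
  apply ext_ofConv
  intro x
  rw [rightTr_apply, ofConv_mul, Bialgebra.comul_mul, hy, Finset.mul_sum, map_sum,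
    WithConv.ofConv_sum, LinearMap.sum_apply]
  exact Finset.sum_congr rfl fun l _ => by rw [pair_mul_tmul, ofConv_mul]

theorem rightTr_rightTr (x y : H) (a : ConvDual k H) :
    rightTr x (rightTr y a) = rightTr (x * y) a :=
  ext_ofConv fun z => by simp [mul_assoc]

theorem rightTr_sum {N : Type*} (s : Finset N) (y : N → H) (a : ConvDual k H) :
    rightTr (∑ i ∈ s, y i) a = ∑ i ∈ s, rightTr (y i) a :=
  ext_ofConv fun z => by simp [Finset.mul_sum, WithConv.ofConv_sum]

theorem pair_tmul_mul (a b : ConvDual k H) (z : H ⊗[k] H) (g : H) :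
    pair a b (g ⊗ₜ g * z) = pair (WithConv.toConv (a.ofConv ∘ₗ LinearMap.mulLeft k g))
      (WithConv.toConv (b.ofConv ∘ₗ LinearMap.mulLeft k g)) z := by
  induction z using TensorProduct.induction_on with
  | zero => simp
  | tmul x y => simp
  | add x y hx hy => simp [mul_add, hx, hy]

/-- Left translation of functionals by a grouplike element, `a ↦ a(g ·)`. -/
noncomputable def leftTrHom (g : GroupLike k H) : ConvDual k H →ₐ[k] ConvDual k H :=
  AlgHom.ofLinearMap
    { toFun := fun a => WithConv.toConv (a.ofConv ∘ₗ LinearMap.mulLeft k g.val)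
      map_add' := fun _ _ => rfl
      map_smul' := fun _ _ => rfl }
    (by
      apply ext_ofConv
      intro x
      change (1 : ConvDual k H).ofConv (g.val * x) = _
      rw [ofConv_one, ofConv_one, Bialgebra.counit_mul, g.isGroupLikeElem_val.counit_eq_one,
        one_mul])
    (fun a b => by
      apply ext_ofConv
      intro x
      change (a * b).ofConv (g.val * x) = _
      rw [ofConv_mul, Bialgebra.comul_mul, g.isGroupLikeElem_val.comul_eq_tmul_self,
        pair_tmul_mul]
      rfl)

@[simp] theorem leftTrHom_apply (g : GroupLike k H) (a : ConvDual k H) (x : H) :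
    (leftTrHom g a).ofConv x = a.ofConv (g.val * x) := rfl

/-- Left translation by a grouplike element as an automorphism. -/
noncomputable def leftTr (g : GroupLike k H) : ConvDual k H ≃ₐ[k] ConvDual k H :=
  AlgEquiv.ofAlgHom (leftTrHom g) (leftTrHom g⁻¹)
    (by
      ext a : 1
      apply ext_ofConv
      intro x
      simp only [AlgHom.comp_apply, leftTrHom_apply, AlgHom.id_apply, ← mul_assoc,
        ← GroupLike.val_mul, inv_mul_cancel, GroupLike.val_one, one_mul])
    (by
      ext a : 1
      apply ext_ofConv
      intro x
      simp only [AlgHom.comp_apply, leftTrHom_apply, AlgHom.id_apply, ← mul_assoc,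
        ← GroupLike.val_mul, mul_inv_cancel, GroupLike.val_one, one_mul])

@[simp] theorem leftTr_apply (g : GroupLike k H) (a : ConvDual k H) (x : H) :
    (leftTr g a).ofConv x = a.ofConv (g.val * x) := rfl

section Mat

variable {N N' : Type*} [Fintype N] [DecidableEq N] [Fintype N'] [DecidableEq N']

theorem IsMulMat.kronecker {m : N → N → H} {m' : N' → N' → H} (hm : IsMulMat k m)
    (hm' : IsMulMat k m') :
    IsMulMat k (fun i j : N × N' => m i.1 j.1 * m' i.2 j.2) where
  comul i j := by
    rw [Bialgebra.comul_mul, hm.comul, hm'.comul, Finset.sum_mul_sum, Fintype.sum_prod_type]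
    simp
  counit i j := by
    rw [Bialgebra.counit_mul, hm.counit, hm'.counit]
    simp only [Prod.ext_iff, ite_and, mul_ite, mul_one, mul_zero]
    split_ifs <;> rfl

theorem IsMulMat.grouplike_mul (g : GroupLike k H) {m : N → N → H} (hm : IsMulMat k m) :
    IsMulMat k (fun i j => g.val * m i j) where
  comul i j := by
    rw [Bialgebra.comul_mul, hm.comul, g.isGroupLikeElem_val.comul_eq_tmul_self, Finset.mul_sum]
    simp
  counit i j := by
    rw [Bialgebra.counit_mul, hm.counit, g.isGroupLikeElem_val.counit_eq_one, one_mul]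

theorem IsMulMat.sum_mul_antipode {m : N → N → H} (hm : IsMulMat k m) (i j : N) :
    ∑ l, m i l * HopfAlgebraStruct.antipode k (m l j) = if i = j then 1 else 0 := by
  have := HopfAlgebra.mul_antipode_lTensor_comul_apply (R := k) (m i j)
  rw [hm.comul, hm.counit] at this
  simp only [map_sum, LinearMap.lTensor_tmul, LinearMap.mul'_apply] at this
  rw [this]
  split_ifs <;> simp

theorem IsMulMat.sum_antipode_mul {m : N → N → H} (hm : IsMulMat k m) (i j : N) :
    ∑ l, HopfAlgebraStruct.antipode k (m i l) * m l j = if i = j then 1 else 0 := by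
  have := HopfAlgebra.mul_antipode_rTensor_comul_apply (R := k) (m i j)
  rw [hm.comul, hm.counit] at this
  simp only [map_sum, LinearMap.rTensor_tmul, LinearMap.mul'_apply] at this
  rw [this]
  split_ifs <;> simp

/-- The trace of left multiplication is multiplied by `n` under translation by the trace of an
`n × n` multiplicative matrix. -/
theorem IsMulMat.trace_mulLeft_rightTr [FiniteDimensional k H] {m : N → N → H}
    (hm : IsMulMat k m) (a : ConvDual k H) :
    LinearMap.trace k _ (LinearMap.mulLeft k (rightTr (∑ i, m i i) a)) =
      Fintype.card N * LinearMap.trace k _ (LinearMap.mulLeft k a) := by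
  let T : N → N → Module.End k (ConvDual k H) := fun i j => rightTr (m i j)
  let T' : N → N → Module.End k (ConvDual k H) :=
    fun i j => rightTr (HopfAlgebraStruct.antipode k (m i j))
  let L : ConvDual k H → Module.End k (ConvDual k H) := fun a => LinearMap.mulLeft k a
  have hTT' : ∀ i j, ∑ l, T i l * T' l j = if i = j then 1 else 0 := by
    intro i j
    ext b : 1
    rw [LinearMap.sum_apply]
    simp only [T, T', Module.End.mul_apply, rightTr_rightTr]
    rw [← rightTr_sum, hm.sum_mul_antipode]
    apply ext_ofConv
    intro x
    split_ifs <;> simp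
  have hT'T : ∀ i j, ∑ l, T' i l * T l j = if i = j then 1 else 0 := by
    intro i j
    ext b : 1
    rw [LinearMap.sum_apply]
    simp only [T, T', Module.End.mul_apply, rightTr_rightTr]
    rw [← rightTr_sum, hm.sum_antipode_mul]
    apply ext_ofConv
    intro x
    split_ifs <;> simp
  have hTL : ∀ i j, T i j * L a = ∑ l, L (T i l a) * T l j := by
    intro i j
    ext b : 1
    rw [LinearMap.sum_apply]
    exact rightTr_mul (hm.comul i j) a b
  have hB : ∀ i j, L (T i j a) = ∑ l, T i l * L a * T' l j := by
    intro i j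
    simp only [hTL, Finset.sum_mul]
    rw [Finset.sum_comm]
    simp only [mul_assoc, ← Finset.mul_sum, hTT']
    simp
  have h1 : LinearMap.mulLeft k (rightTr (∑ i, m i i) a) = ∑ i, L (T i i a) := by
    rw [rightTr_sum]
    ext b : 1
    simp [L, T, Finset.sum_mul]
  rw [h1]
  simp only [hB, map_sum]
  rw [Finset.sum_comm]
  have h2 : ∀ l, ∑ i, LinearMap.trace k _ (T i l * L a * T' l i) =
      LinearMap.trace k _ (L a) := by
    intro l
    have : ∀ i, LinearMap.trace k _ (T i l * L a * T' l i) =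
        LinearMap.trace k _ (L a * (T' l i * T i l)) := by
      intro i
      rw [mul_assoc, LinearMap.trace_mul_comm, mul_assoc]
    simp only [this]
    rw [← map_sum, ← Finset.mul_sum, hT'T, if_pos rfl, mul_one]
  simp only [h2]
  simp [L]

end Mat

end Hopf

/-- The degrees of the simple subcoalgebras: one for grouplikes, `d v` for the others. -/
abbrev degrees (G : Type*) {V : Type*} (d : V → ℕ) : G ⊕ V → ℕ := Sum.elim (fun _ => 1) d

instance {G V : Type*} {d : V → ℕ} [∀ v, NeZero (d v)] (S : G ⊕ V) : NeZero (degrees G d S) := by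
  cases S <;> simp only [degrees, Sum.elim_inl, Sum.elim_inr] <;> infer_instance

/-- The dual algebra presented through the matrix coefficients of the simple subcoalgebras. -/
structure CoradData (k H : Type*) [Field k] [Ring H] [HopfAlgebra k H] [Fintype (GroupLike k H)]
    [DecidableEq (GroupLike k H)] {V : Type*} [Fintype V] [DecidableEq V] (d : V → ℕ) extends
    SplitAlg k (ConvDual k H) (degrees (GroupLike k H) d) where
  mat : ∀ S, Fin (degrees (GroupLike k H) d S) → Fin (degrees (GroupLike k H) d S) → H
  isMul : ∀ S, IsMulMat k (mat S)
  φ_apply : ∀ a S i j, φ a S i j = a.ofConv (mat S i j)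
  mat_inl : ∀ g i j, mat (Sum.inl g) i j = g.val

namespace CoradData

variable {k H : Type*} [Field k] [Ring H] [HopfAlgebra k H] [Fintype (GroupLike k H)]
  [DecidableEq (GroupLike k H)] {V : Type*} [Fintype V] [DecidableEq V] {d : V → ℕ}
  (B : CoradData k H d)

/-- The character of a simple subcoalgebra. -/
def χ (S : GroupLike k H ⊕ V) : H := ∑ i, B.mat S i i

theorem χ_inl (g : GroupLike k H) : B.χ (Sum.inl g) = g.val := by
  change ∑ i : Fin 1, B.mat (Sum.inl g) i i = _
  rw [Fin.sum_univ_one]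
  exact B.mat_inl _ _ _

theorem trace_φ (a : ConvDual k H) (S) : (B.φ a S).trace = a.ofConv (B.χ S) := by
  simp only [Matrix.trace, Matrix.diag, B.φ_apply, χ, map_sum]

theorem e_χ (i) (S) : (B.e i).ofConv (B.χ S) = if i.1 = S then 1 else 0 := by
  rw [← trace_φ, B.φ_e]
  split_ifs with h
  · subst h
    rw [Pi.single_eq_same, Matrix.trace_single_eq_same]
  · rw [Pi.single_eq_of_ne (Ne.symm h), Matrix.trace_zero]

variable [∀ v, NeZero (d v)]

/-- The coefficient functional of a simple character. -/
def coef (S : GroupLike k H ⊕ V) : ConvDual k H := B.e ⟨S, 0⟩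

theorem coef_χ (S T) : (B.coef S).ofConv (B.χ T) = if S = T then 1 else 0 := B.e_χ _ _

theorem coef_val (S) (g : GroupLike k H) :
    (B.coef S).ofConv g.val = if S = Sum.inl g then 1 else 0 := by
  rw [← B.χ_inl, coef_χ]

theorem coef_sum (S) (c : GroupLike k H ⊕ V → k) :
    (B.coef S).ofConv (∑ T, c T • B.χ T) = c S := by
  simp only [map_sum, map_smul, smul_eq_mul, coef_χ, mul_ite, mul_one, mul_zero,
    Finset.sum_ite_eq, Finset.mem_univ, if_true]

theorem χ_injective : Function.Injective B.χ := by
  intro S T h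
  by_contra hne
  have h1 := B.coef_χ S T
  rw [← h, coef_χ, if_pos rfl, if_neg hne] at h1
  exact one_ne_zero h1

variable [CharZero k]

theorem exists_character {N : Type*} [Fintype N] [DecidableEq N] {m : N → N → H}
    (hm : IsMulMat k m) : ∃ c : GroupLike k H ⊕ V → ℕ,
      ∑ i, m i i = ∑ S, (c S : k) • B.χ S ∧
      Fintype.card N = ∑ S, c S * degrees (GroupLike k H) d S := by
  obtain ⟨c, -, htr, hcard⟩ := B.exists_multiplicity
    ((Matrix.toLinAlgEquiv' : Matrix N N k ≃ₐ[k] _).toAlgHom.comp hm.hom)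
  refine ⟨c, eq_of_forall_ofConv (k := k) fun a => ?_, by simpa using hcard⟩
  have h := htr a
  have h1 : LinearMap.trace k (N → k)
      ((Matrix.toLinAlgEquiv' : Matrix N N k ≃ₐ[k] _).toAlgHom.comp hm.hom a) =
      (hm.hom a).trace := Matrix.trace_toLin'_eq _
  rw [h1] at h
  simp only [map_sum, map_smul, smul_eq_mul, ← trace_φ]
  rw [← h]
  rfl

variable [FiniteDimensional k H]

/-- The rank of the right ideal generated by a primitive idempotent. -/
noncomputable def rk (S : GroupLike k H ⊕ V) : ℕ :=
  Module.finrank k (LinearMap.range (LinearMap.mulLeft k (B.coef S)))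

theorem rk_spec : (∀ i, Module.finrank k (LinearMap.range (LinearMap.mulLeft k (B.e i))) =
      B.rk i.1) ∧
    (∀ a : ConvDual k H, LinearMap.trace k _ (LinearMap.mulLeft k a) =
      a.ofConv (∑ S, (B.rk S : k) • B.χ S)) ∧
    Module.finrank k H = ∑ S, B.rk S * degrees (GroupLike k H) d S := by
  obtain ⟨c, hc, htr, hcard⟩ := B.exists_multiplicity (Algebra.lmul k (ConvDual k H))
  have h : B.rk = c := funext fun S => hc ⟨S, 0⟩
  rw [h]
  refine ⟨hc, fun a => ?_, by rw [← hcard, finrank_convDual]⟩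
  rw [map_sum]
  simp only [map_smul, smul_eq_mul, ← trace_φ]
  exact htr a

/-- The character of the regular representation of the dual. -/
noncomputable def regChar : H := ∑ S, (B.rk S : k) • B.χ S

theorem trace_mulLeft (a : ConvDual k H) :
    LinearMap.trace k _ (LinearMap.mulLeft k a) = a.ofConv B.regChar := B.rk_spec.2.1 a

theorem degrees_le_rk (S) : degrees (GroupLike k H) d S ≤ B.rk S := by
  refine B.le_finrank_of_mul_ne_zero _ ?_ (y := B.coef S) ?_ ⟨S, 0⟩ ?_
  · rintro _ ⟨x, rfl⟩ a
    exact ⟨x * a, by simp [mul_assoc]⟩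
  · exact ⟨1, by simp⟩
  · rw [coef, B.mul_e_self]
    intro h
    have := B.coef_χ S S
    rw [coef, h] at this
    simp at this

theorem regChar_mul {N : Type*} [Fintype N] [DecidableEq N] {m : N → N → H}
    (hm : IsMulMat k m) : B.regChar * ∑ i, m i i = (Fintype.card N : k) • B.regChar := by
  apply eq_of_forall_ofConv (k := k)
  intro a
  rw [← rightTr_apply, ← B.trace_mulLeft, hm.trace_mulLeft_rightTr, B.trace_mulLeft]
  simp

theorem val_mul_regChar (g : GroupLike k H) : g.val * B.regChar = B.regChar := by
  apply eq_of_forall_ofConv (k := k)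
  intro a
  rw [← leftTr_apply, ← B.trace_mulLeft, ← B.trace_mulLeft,
    ← LinearMap.trace_conj' (LinearMap.mulLeft k a) (leftTr g).toLinearEquiv]
  congr 1
  ext b : 1
  obtain ⟨c, rfl⟩ := (leftTr g).surjective b
  rw [LinearEquiv.conj_apply_apply]
  have : (leftTr g).toLinearEquiv.symm (leftTr g c) = c := (leftTr g).symm_apply_apply c
  rw [this]
  exact (map_mul (leftTr g) a c).symm

end CoradData

namespace CoradData

variable {k H : Type*} [Field k] [Ring H] [HopfAlgebra k H] [Fintype (GroupLike k H)]
  [DecidableEq (GroupLike k H)] {V : Type*} [Fintype V] [DecidableEq V] {d : V → ℕ}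
  (B : CoradData k H d) [∀ v, NeZero (d v)] [CharZero k] {q : ℕ}

theorem sum_degrees (hd : ∀ v, d v = q) (c : GroupLike k H ⊕ V → ℕ) :
    ∑ S, c S * degrees (GroupLike k H) d S = ∑ g, c (Sum.inl g) + q * ∑ v, c (Sum.inr v) := by
  rw [Fintype.sum_sum_type, Finset.mul_sum]
  simp [degrees, hd, mul_comm]

theorem exists_val_mul_χ (hd : ∀ v, d v = q) (g : GroupLike k H) (v : V) :
    ∃ w, g.val * B.χ (Sum.inr v) = B.χ (Sum.inr w) := by
  have hq : q ≠ 0 := hd v ▸ NeZero.ne (d v)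
  obtain ⟨c, hc, hcard⟩ := B.exists_character ((B.isMul (Sum.inr v)).grouplike_mul g)
  rw [← Finset.mul_sum] at hc
  change g.val * B.χ (Sum.inr v) = _ at hc
  rw [Fintype.card_fin, sum_degrees hd] at hcard
  change d v = _ at hcard
  rw [hd] at hcard
  by_cases h : ∃ w, c (Sum.inr w) ≠ 0
  · obtain ⟨w, hw⟩ := h
    have h1 : c (Sum.inr w) ≤ ∑ v, c (Sum.inr v) :=
      Finset.single_le_sum (f := fun v => c (Sum.inr v)) (fun _ _ => Nat.zero_le _)
        (Finset.mem_univ _)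
    have h2 : ∑ v, c (Sum.inr v) ≤ 1 := by
      by_contra! hlt
      have : q * 2 ≤ q * ∑ v, c (Sum.inr v) := Nat.mul_le_mul_left q hlt
      omega
    have h3 : ∑ v, c (Sum.inr v) = 1 := by omega
    rw [h3] at hcard
    have h4 : ∑ g, c (Sum.inl g) = 0 := by omega
    have h5 : c (Sum.inr w) = 1 := by omega
    have h6 : ∑ v ∈ Finset.univ.erase w, c (Sum.inr v) = 0 := by
      have := Finset.add_sum_erase Finset.univ (fun v => c (Sum.inr v)) (Finset.mem_univ w)
      omega
    refine ⟨w, ?_⟩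
    rw [hc, Finset.sum_eq_single (Sum.inr w), h5, Nat.cast_one, one_smul]
    · rintro (g' | w') _ hne
      · rw [Finset.sum_eq_zero_iff.1 h4 g' (Finset.mem_univ _), Nat.cast_zero, zero_smul]
      · rw [Finset.sum_eq_zero_iff.1 h6 w' (Finset.mem_erase.2
          ⟨fun h => hne (by rw [h]), Finset.mem_univ _⟩), Nat.cast_zero, zero_smul]
    · simp
  · push Not at h
    exfalso
    have h1 : B.χ (Sum.inr v) = ∑ h, (c (Sum.inl h) : k) • (g⁻¹ * h).val := by
      have h2 := congrArg (g⁻¹.val * ·) hc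
      simp only [← mul_assoc, ← GroupLike.val_mul, inv_mul_cancel, GroupLike.val_one,
        one_mul, Fintype.sum_sum_type, h, Nat.cast_zero, zero_smul, Finset.sum_const_zero,
        add_zero, Finset.mul_sum, mul_smul_comm, χ_inl] at h2
      exact h2
    have h3 := B.coef_χ (Sum.inr v) (Sum.inr v)
    rw [h1] at h3
    simp only [map_sum, map_smul, coef_val, reduceCtorEq, if_false, smul_zero,
      Finset.sum_const_zero, if_true] at h3
    exact zero_ne_one h3

/-- The permutation of the characters of equal degree induced by a grouplike element. -/
noncomputable def translate (hd : ∀ v, d v = q) (g : GroupLike k H) (v : V) : V :=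
  (B.exists_val_mul_χ hd g v).choose

theorem val_mul_χ_eq (hd : ∀ v, d v = q) (g : GroupLike k H) (v : V) :
    g.val * B.χ (Sum.inr v) = B.χ (Sum.inr (B.translate hd g v)) :=
  (B.exists_val_mul_χ hd g v).choose_spec

/-- Grouplike elements act on the characters of equal degree. -/
noncomputable abbrev action (hd : ∀ v, d v = q) : MulAction (GroupLike k H) V where
  smul := B.translate hd
  one_smul v := by
    have h := B.val_mul_χ_eq hd 1 v
    rw [GroupLike.val_one, one_mul] at h
    exact (Sum.inr_injective (B.χ_injective h)).symm
  mul_smul g h v := by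
    have h1 := B.val_mul_χ_eq hd (g * h) v
    rw [GroupLike.val_mul, mul_assoc, B.val_mul_χ_eq, B.val_mul_χ_eq] at h1
    exact (Sum.inr_injective (B.χ_injective h1)).symm

theorem val_mul_χ (hd : ∀ v, d v = q) (g : GroupLike k H) (v : V) :
    letI := B.action hd
    g.val * B.χ (Sum.inr v) = B.χ (Sum.inr (g • v)) :=
  B.val_mul_χ_eq hd g v

theorem coef_inl_val_mul (hd : ∀ v, d v = q) (g h : GroupLike k H)
    (c : GroupLike k H ⊕ V → k) :
    (B.coef (Sum.inl (g * h))).ofConv (g.val * ∑ S, c S • B.χ S) = c (Sum.inl h) := by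
  rw [← B.coef_sum (Sum.inl h) c]
  simp only [Finset.mul_sum, map_sum, mul_smul_comm, map_smul]
  refine Finset.sum_congr rfl fun S _ => ?_
  congr 1
  rcases S with g' | v
  · rw [χ_inl, ← GroupLike.val_mul, coef_val, coef_val]
    simp
  · rw [B.val_mul_χ hd, coef_χ, coef_χ]
    simp

theorem coef_inr_val_mul (hd : ∀ v, d v = q) (g : GroupLike k H) (v : V)
    (c : GroupLike k H ⊕ V → k) :
    letI := B.action hd
    (B.coef (Sum.inr (g • v))).ofConv (g.val * ∑ S, c S • B.χ S) = c (Sum.inr v) := by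
  let := B.action hd
  rw [← B.coef_sum (Sum.inr v) c]
  simp only [Finset.mul_sum, map_sum, mul_smul_comm, map_smul]
  refine Finset.sum_congr rfl fun S _ => ?_
  congr 1
  rcases S with g' | w
  · rw [χ_inl, ← GroupLike.val_mul, coef_val, coef_val]
    simp
  · rw [B.val_mul_χ hd, coef_χ, coef_χ]
    simp

theorem exists_prodCoef (hd : ∀ v, d v = q) (w v : V) : ∃ c : GroupLike k H ⊕ V → ℕ,
    B.χ (Sum.inr w) * B.χ (Sum.inr v) = ∑ S, (c S : k) • B.χ S ∧
    q * q = ∑ g, c (Sum.inl g) + q * ∑ v, c (Sum.inr v) := by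
  obtain ⟨c, hc, hcard⟩ := B.exists_character ((B.isMul (Sum.inr w)).kronecker
    (B.isMul (Sum.inr v)))
  refine ⟨c, ?_, ?_⟩
  · rw [← hc, χ, χ, Finset.sum_mul_sum, Fintype.sum_prod_type]
  · rw [sum_degrees hd, Fintype.card_prod, Fintype.card_fin, Fintype.card_fin] at hcard
    rw [← hcard]
    change q * q = d w * d v
    rw [hd, hd]

variable [FiniteDimensional k H]

theorem rk_inl (hd : ∀ v, d v = q) (g : GroupLike k H) :
    B.rk (Sum.inl g) = B.rk (Sum.inl 1) := by
  have h1 := B.coef_inl_val_mul hd g 1 (fun S => (B.rk S : k))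
  change (B.coef (Sum.inl (g * 1))).ofConv (g.val * B.regChar) = _ at h1
  rw [B.val_mul_regChar, regChar, coef_sum, mul_one] at h1
  exact_mod_cast h1

theorem rk_inr_smul (hd : ∀ v, d v = q) (g : GroupLike k H) (v : V) :
    letI := B.action hd
    B.rk (Sum.inr (g • v)) = B.rk (Sum.inr v) := by
  let := B.action hd
  have h1 := B.coef_inr_val_mul hd g v (fun S => (B.rk S : k))
  change (B.coef (Sum.inr (g • v))).ofConv (g.val * B.regChar) = _ at h1
  rw [B.val_mul_regChar, regChar, coef_sum] at h1
  exact_mod_cast h1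

/-- The multiplicity of the unit in the product of two characters. -/
noncomputable def unitMult (hd : ∀ v, d v = q) (w v : V) : ℕ :=
  (B.exists_prodCoef hd w v).choose (Sum.inl 1)

theorem mul_rk_one (hd : ∀ v, d v = q) (v : V) :
    q * B.rk (Sum.inl 1) = ∑ w, B.rk (Sum.inr w) * B.unitMult hd w v := by
  have h1 := B.regChar_mul (B.isMul (Sum.inr v))
  change B.regChar * B.χ (Sum.inr v) = _ at h1
  have h2 := congrArg (B.coef (Sum.inl 1)).ofConv h1
  rw [map_smul, Fintype.card_fin] at h2
  change _ = (d v : k) • _ at h2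
  rw [hd] at h2
  conv_rhs at h2 => rw [regChar, coef_sum]
  rw [regChar, Finset.sum_mul, map_sum, Fintype.sum_sum_type] at h2
  rw [Finset.sum_eq_zero, zero_add] at h2
  · have h3 : ∀ w, (B.coef (Sum.inl 1)).ofConv
        ((B.rk (Sum.inr w) : k) • B.χ (Sum.inr w) * B.χ (Sum.inr v)) =
        (B.rk (Sum.inr w) : k) * B.unitMult hd w v := by
      intro w
      rw [smul_mul_assoc, (B.exists_prodCoef hd w v).choose_spec.1, map_smul, coef_sum]
      rfl
    simp only [h3, smul_eq_mul] at h2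
    exact_mod_cast h2.symm
  · intro g _
    rw [smul_mul_assoc, χ_inl, B.val_mul_χ hd, map_smul, coef_χ]
    simp

omit [FiniteDimensional k H] in
theorem dvd_sum_unitMult (hd : ∀ v, d v = q) (hcard : Fintype.card (GroupLike k H) = q + 1)
    (v : V) : q ∣ ∑ w, B.unitMult hd w v := by
  let := B.action hd
  let c : V → GroupLike k H ⊕ V → ℕ := fun w => (B.exists_prodCoef hd w v).choose
  have hc : ∀ w, B.χ (Sum.inr w) * B.χ (Sum.inr v) = ∑ S, (c w S : k) • B.χ S :=
    fun w => (B.exists_prodCoef hd w v).choose_spec.1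
  have hq : ∀ w, q * q = ∑ g, c w (Sum.inl g) + q * ∑ v, c w (Sum.inr v) :=
    fun w => (B.exists_prodCoef hd w v).choose_spec.2
  have hX : (∑ w, B.χ (Sum.inr w)) * B.χ (Sum.inr v) =
      ∑ S, ((∑ w, c w S : ℕ) : k) • B.χ S := by
    rw [Finset.sum_mul]
    simp only [hc]
    rw [Finset.sum_comm]
    simp only [Nat.cast_sum, Finset.sum_smul]
  have hinv : ∀ g : GroupLike k H, g.val * ∑ w, B.χ (Sum.inr w) = ∑ w, B.χ (Sum.inr w) := by
    intro g
    rw [Finset.mul_sum]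
    simp only [B.val_mul_χ hd]
    exact Equiv.sum_comp (MulAction.toPerm g) (fun w => B.χ (Sum.inr w))
  have hconst : ∀ g, ∑ w, c w (Sum.inl g) = ∑ w, c w (Sum.inl 1) := by
    intro g
    have h1 := B.coef_inl_val_mul hd g 1 (fun S => ((∑ w, c w S : ℕ) : k))
    rw [← hX, ← mul_assoc, hinv, hX, coef_sum, mul_one] at h1
    exact_mod_cast h1
  have hsum : ∑ w : V, q * q =
      (q + 1) * ∑ w, c w (Sum.inl 1) + q * ∑ w, ∑ v, c w (Sum.inr v) := by
    rw [Finset.sum_congr rfl fun w _ => hq w, Finset.sum_add_distrib, Finset.sum_comm,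
      Finset.sum_congr rfl fun g _ => hconst g, ← Finset.mul_sum, Finset.sum_const,
      Finset.card_univ, hcard, smul_eq_mul]
  rw [Finset.sum_const, smul_eq_mul] at hsum
  change q ∣ ∑ w, c w (Sum.inl 1)
  have h1 : q ∣ (q + 1) * ∑ w, c w (Sum.inl 1) := by
    rw [← Nat.dvd_add_left (Dvd.intro _ rfl : q ∣ q * ∑ w, ∑ v, c w (Sum.inr v)), ← hsum]
    exact Dvd.dvd.mul_left (Dvd.intro _ rfl) _
  exact (Nat.Coprime.dvd_mul_left (by simp)).1 h1

theorem exists_smul_ne (hd : ∀ v, d v = q) (hcard : Fintype.card (GroupLike k H) = q + 1)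
    (v : V) : letI := B.action hd
    ∃ (g : GroupLike k H) (w : V), g • w ≠ w := by
  let := B.action hd
  by_contra! hfix
  have hq : 0 < q := Nat.pos_of_ne_zero (hd v ▸ NeZero.ne (d v))
  have h0 : ∀ w, B.unitMult hd w v = 0 := by
    intro w
    let c : GroupLike k H ⊕ V → ℕ := (B.exists_prodCoef hd w v).choose
    have hc : B.χ (Sum.inr w) * B.χ (Sum.inr v) = ∑ S, (c S : k) • B.χ S :=
      (B.exists_prodCoef hd w v).choose_spec.1
    have hqq : q * q = ∑ g, c (Sum.inl g) + q * ∑ v, c (Sum.inr v) :=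
      (B.exists_prodCoef hd w v).choose_spec.2
    change c (Sum.inl 1) = 0
    have hconst : ∀ g, c (Sum.inl g) = c (Sum.inl 1) := by
      intro g
      have h1 := B.coef_inl_val_mul hd g 1 (fun S => (c S : k))
      rw [← hc, ← mul_assoc, B.val_mul_χ hd, hfix, hc, coef_sum, mul_one] at h1
      exact_mod_cast h1
    simp only [hconst, Finset.sum_const, Finset.card_univ, hcard, smul_eq_mul] at hqq
    have h1 : q ∣ (q + 1) * c (Sum.inl 1) := by
      rw [← Nat.dvd_add_left (Dvd.intro _ rfl : q ∣ q * ∑ v, c (Sum.inr v)), ← hqq]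
      exact Dvd.intro _ rfl
    obtain ⟨x, hx⟩ := (Nat.Coprime.dvd_mul_left (by simp)).1 h1
    rw [hx] at hqq ⊢
    by_contra hne
    have : x ≠ 0 := by rintro rfl; simp at hne
    have hx1 : 1 ≤ x := by omega
    nlinarith [Nat.mul_le_mul hq.le hx1, Nat.zero_le (q * ∑ v, c (Sum.inr v)),
      Nat.mul_le_mul_left (q * q) hx1, Nat.mul_le_mul_left q hx1]
  have h1 := B.mul_rk_one hd v
  simp only [h0, mul_zero, Finset.sum_const_zero] at h1
  have h2 := B.degrees_le_rk (Sum.inl 1)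
  change 1 ≤ _ at h2
  rcases Nat.mul_eq_zero.1 h1 with h | h <;> omega

theorem rk_eq_of_card_eq (hd : ∀ v, d v = q) (hcard : Fintype.card (GroupLike k H) = q + 1)
    (hp : (q + 1).Prime) (hq : 2 ≤ q) (hV : Fintype.card V = q + 1)
    (hdim : Module.finrank k H = (q + 1) ^ 3) : ∃ v, B.rk (Sum.inr v) = q + 1 := by
  classical
  let := B.action hd
  obtain ⟨v₀⟩ : Nonempty V := Fintype.card_pos_iff.1 (by omega)
  obtain ⟨g, v, hgv⟩ := B.exists_smul_ne hd hcard v₀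
  have horb : Nat.card (MulAction.orbit (GroupLike k H) v) = q + 1 := by
    have h1 := MulAction.card_orbit_mul_card_stabilizer_eq_card_group (GroupLike k H) v
    rw [hcard, ← Nat.card_eq_fintype_card] at h1
    rcases (Nat.dvd_prime hp).1 (Dvd.intro _ h1) with h2 | h2
    · exfalso
      rw [Nat.card_eq_one_iff_unique] at h2
      have := h2.1
      exact hgv (congrArg Subtype.val (Subsingleton.elim
        (⟨g • v, MulAction.mem_orbit _ _⟩ : MulAction.orbit (GroupLike k H) v)
        ⟨v, MulAction.mem_orbit_self _⟩))
    · exact h2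
  have htrans : MulAction.orbit (GroupLike k H) v = Set.univ := by
    apply Set.eq_of_subset_of_ncard_le (Set.subset_univ _)
    rw [Set.ncard_univ, Nat.card_eq_fintype_card, hV, ← horb, Nat.card_coe_set_eq]
  have hrk : ∀ w, B.rk (Sum.inr w) = B.rk (Sum.inr v) := by
    intro w
    obtain ⟨g, rfl⟩ : w ∈ MulAction.orbit (GroupLike k H) v := htrans ▸ Set.mem_univ w
    exact B.rk_inr_smul hd g v
  refine ⟨v, ?_⟩
  have h1 := B.mul_rk_one hd v
  obtain ⟨M, hM⟩ := B.dvd_sum_unitMult hd hcard v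
  have h2 := B.rk_spec.2.2
  rw [sum_degrees hd, hdim] at h2
  have hrk' : ∀ g, B.rk (Sum.inl g) = B.rk (Sum.inl 1) := B.rk_inl hd
  simp only [hrk] at h1 h2
  simp only [hrk', Finset.sum_const, Finset.card_univ, hV, hcard, smul_eq_mul] at h2
  rw [← Finset.mul_sum, hM] at h1
  have h3 := B.degrees_le_rk (Sum.inr v)
  change d v ≤ _ at h3
  rw [hd] at h3
  have h4 := B.degrees_le_rk (Sum.inl 1)
  change 1 ≤ _ at h4
  generalize B.rk (Sum.inr v) = x at *
  generalize B.rk (Sum.inl 1) = r at *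
  have h5 : r = x * M := Nat.eq_of_mul_eq_mul_left (show 0 < q by omega) (by rw [h1]; ring)
  subst h5
  have h6 : (q + 1) ^ 2 = x * (M + q) :=
    Nat.eq_of_mul_eq_mul_left (show 0 < q + 1 by omega) (by
      calc (q + 1) * (q + 1) ^ 2 = (q + 1) ^ 3 := by ring
        _ = _ := h2
        _ = _ := by ring)
  have hM1 : 1 ≤ M := by
    rcases Nat.eq_zero_or_pos M with rfl | h
    · simp at h4
    · exact h
  obtain ⟨i, hi, rfl⟩ := (Nat.dvd_prime_pow hp).1 (Dvd.intro _ h6.symm)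
  interval_cases i
  · simp at h3; omega
  · simp
  · have : M + q = 1 := Nat.eq_of_mul_eq_mul_left (show 0 < (q + 1) ^ 2 by positivity)
      (by rw [← h6, mul_one])
    omega

theorem rk_eq_degrees (h : Module.finrank k H =
    ∑ S, degrees (GroupLike k H) d S * degrees (GroupLike k H) d S) (S) :
    B.rk S = degrees (GroupLike k H) d S := by
  have h1 := B.rk_spec.2.2
  rw [h, Finset.sum_eq_sum_iff_of_le fun S _ => Nat.mul_le_mul_right _ (B.degrees_le_rk S)] at h1
  exact (Nat.eq_of_mul_eq_mul_right (Nat.pos_of_ne_zero (NeZero.ne _))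
    (h1 S (Finset.mem_univ S))).symm

theorem finrank_ne_sum_degrees_sq (B : CoradData k H d) (hd : ∀ v, d v = q)
    (hcard : Fintype.card (GroupLike k H) = q + 1) (hq : 2 ≤ q) (v : V) :
    Module.finrank k H ≠
      ∑ S, degrees (GroupLike k H) d S * degrees (GroupLike k H) d S := by
  intro h
  have h1 := B.mul_rk_one hd v
  simp only [B.rk_eq_degrees h, degrees, Sum.elim_inl, Sum.elim_inr, hd, ← Finset.mul_sum] at h1
  have h2 := Nat.eq_of_mul_eq_mul_left (by omega) h1
  have h3 := Nat.le_of_dvd one_pos (h2 ▸ B.dvd_sum_unitMult hd hcard v)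
  omega

end CoradData

theorem exists_of_finrank_ker_eq_one {k W W' : Type*} [Field k] [AddCommGroup W] [Module k W]
    [AddCommGroup W'] [Module k W'] {E : Submodule k W} (R : E →ₗ[k] W')
    (h : Module.finrank k (LinearMap.ker R) = 1) :
    ∃ v : LinearMap.ker R, v ≠ 0 ∧ ∀ w, ∃ c : k, c • v = w :=
  finrank_eq_one_iff'.1 h

namespace SplitAlg

variable {k A ι : Type*} [Field k] [Ring A] [Algebra k A] [FiniteDimensional k A] [Fintype ι]
  [DecidableEq ι] {n : ι → ℕ} (B : SplitAlg k A n)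

/-- A primitive right ideal whose radical is one-dimensional contains an eigenvector. -/
theorem exists_eigenvector (i : Σ S, Fin (n S))
    (h : Module.finrank k (LinearMap.range (LinearMap.mulLeft k (B.e i))) = n i.1 + 1) :
    ∃ f ≠ 0, B.e i * f = f ∧ ∃ θ : A →ₐ[k] k, ∀ a, f * a = θ a • f := by
  let E := LinearMap.range (LinearMap.mulLeft k (B.e i))
  let R : E →ₗ[k] (Fin (n i.1) → k) :=
    { toFun := fun x => B.φ x.1 i.1 i.2
      map_add' := fun x y => by
        ext j
        simp
      map_smul' := fun c x => by
        ext j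
        simp }
  have hE : ∀ x ∈ E, B.e i * x = x := by
    rintro _ ⟨y, rfl⟩
    rw [LinearMap.mulLeft_apply, ← mul_assoc, B.mul_e_self]
  have hsurj : Function.Surjective R := by
    intro u
    obtain ⟨a, ha⟩ := B.surj (Pi.single i.1 (Matrix.of fun _ j => u j))
    refine ⟨⟨B.e i * a, a, rfl⟩, ?_⟩
    change B.φ (B.e i * a) i.1 i.2 = u
    rw [map_mul, ha, Pi.mul_apply, Pi.single_eq_same, B.φ_e, Pi.single_eq_same]
    ext j
    rw [Matrix.single_mul_apply_same]
    exact one_mul _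
  have hker : Module.finrank k (LinearMap.ker R) = 1 := by
    have h1 := R.finrank_range_add_finrank_ker
    rw [LinearMap.range_eq_top.2 hsurj, finrank_top, Module.finrank_fin_fun] at h1
    have h2 : Module.finrank k E = n i.1 + 1 := h
    omega
  obtain ⟨f, hf0, hf⟩ := exists_of_finrank_ker_eq_one R hker
  have hfE : B.e i * f.1.1 = f.1.1 := hE _ f.1.2
  have hex : ∀ a : A, ∃ c : k, f.1.1 * a = c • f.1.1 := by
    intro a
    have hmem : f.1.1 * a ∈ E := ⟨f.1.1 * a, by rw [LinearMap.mulLeft_apply, ← mul_assoc, hfE]⟩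
    have hk : (⟨f.1.1 * a, hmem⟩ : E) ∈ LinearMap.ker R := by
      have h1 : B.φ f.1.1 i.1 i.2 = 0 := f.2
      rw [LinearMap.mem_ker]
      change B.φ (f.1.1 * a) i.1 i.2 = 0
      rw [map_mul, Pi.mul_apply, Matrix.mul_apply_eq_vecMul, h1, Matrix.zero_vecMul]
    obtain ⟨c, hc⟩ := hf ⟨_, hk⟩
    exact ⟨c, (congrArg (fun x => x.1.1) hc).symm⟩
  have h0 : f.1.1 ≠ 0 := fun h => hf0 (Subtype.ext (Subtype.ext h))
  choose θ hθ using hex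
  have hinj : ∀ {c c' : k}, c • f.1.1 = c' • f.1.1 → c = c' :=
    fun h => smul_left_injective k h0 h
  refine ⟨f.1.1, h0, hfE, AlgHom.ofLinearMap
    { toFun := θ
      map_add' := fun a b => hinj (by rw [← hθ, mul_add, hθ, hθ, add_smul])
      map_smul' := fun c a => hinj (by
        rw [← hθ, mul_smul_comm, hθ, smul_smul]; rfl) }
    (hinj (by change θ 1 • f.1.1 = _; rw [← hθ, mul_one, one_smul]))
    (fun a b => hinj (by
      change θ (a * b) • f.1.1 = (θ a * θ b) • f.1.1
      rw [← hθ, ← mul_assoc, hθ, smul_mul_assoc, hθ, smul_smul])), hθ⟩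

end SplitAlg

section Integral

open scoped Coalgebra

variable {k H : Type*} [Field k] [Ring H] [HopfAlgebra k H]

theorem evalLeft_mul_tmul (f : ConvDual k H) (z : H ⊗[k] H) (u w : H) :
    evalLeft f (z * u ⊗ₜ w) = evalLeft f (z * u ⊗ₜ 1) * w := by
  induction z using TensorProduct.induction_on with
  | zero => simp
  | tmul x y => simp
  | add x y hx hy => simp [add_mul, hx, hy]

theorem ofConv_evalLeft (f b : ConvDual k H) (z : H ⊗[k] H) :
    b.ofConv (evalLeft f z) = pair f b z := by
  induction z using TensorProduct.induction_on with
  | zero => simp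
  | tmul x y => simp
  | add x y hx hy => simp [hx, hy]

theorem ofConv_evalRight (f b : ConvDual k H) (z : H ⊗[k] H) :
    f.ofConv (evalRight b z) = pair f b z := by
  induction z using TensorProduct.induction_on with
  | zero => simp
  | tmul x y => simp [mul_comm]
  | add x y hx hy => simp [hx, hy]

/-- The map `x ↦ ∑ f(h₁ x) h₂`. -/
noncomputable def shift (f : ConvDual k H) (h : H) : WithConv (H →ₗ[k] H) :=
  WithConv.toConv (evalLeft f ∘ₗ LinearMap.mulLeft k (CoalgebraStruct.comul (R := k) h) ∘ₗ
    (TensorProduct.mk k H H).flip 1)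

theorem shift_apply (f : ConvDual k H) (h x : H) :
    (shift f h).ofConv x = evalLeft f (CoalgebraStruct.comul (R := k) h * x ⊗ₜ[k] 1) := rfl

theorem ofConv_shift (f b : ConvDual k H) (h x : H) :
    b.ofConv ((shift f h).ofConv x) =
      f.ofConv (evalRight b (CoalgebraStruct.comul (R := k) h) * x) := by
  rw [shift_apply]
  generalize CoalgebraStruct.comul (R := k) h = z
  induction z using TensorProduct.induction_on with
  | zero => simp
  | tmul x y => simp [mul_comm]
  | add x y hx hy => simp [add_mul, hx, hy]

/-- A functional `f` with `∑ f(x₁) x₂ = f(x) 1`. -/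
def IsRightIntegral (f : ConvDual k H) : Prop :=
  ∀ x, evalLeft f (CoalgebraStruct.comul (R := k) x) = f.ofConv x • 1

theorem isRightIntegral_iff {f : ConvDual k H} :
    IsRightIntegral f ↔ ∀ a : ConvDual k H, f * a = a.ofConv 1 • f := by
  constructor
  · intro h a
    apply ext_ofConv
    intro x
    rw [ofConv_mul, ← ofConv_evalLeft, h]
    simp [mul_comm]
  · intro h x
    apply eq_of_forall_ofConv (k := k)
    intro a
    rw [ofConv_evalLeft, ← ofConv_mul, h]
    simp [mul_comm]

namespace IsRightIntegral

variable {f : ConvDual k H} (hf : IsRightIntegral f)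
include hf

theorem shift_mul_id (h : H) :
    shift f h * WithConv.toConv LinearMap.id =
      WithConv.toConv ((LinearMap.toSpanSingleton k H 1) ∘ₗ f.ofConv ∘ₗ LinearMap.mulLeft k h) := by
  apply WithConv.ofConv_injective
  ext x
  have h1 := (ℛ k x).convMul_apply (shift f h) (WithConv.toConv LinearMap.id)
  refine h1.trans ?_
  change ∑ i ∈ (ℛ k x).index, (shift f h).ofConv ((ℛ k x).left i) * (ℛ k x).right i =
    f.ofConv (h * x) • 1
  rw [← hf, Bialgebra.comul_mul, ← (ℛ k x).eq, Finset.mul_sum, map_sum]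
  exact Finset.sum_congr rfl fun i _ => by rw [evalLeft_mul_tmul]; rfl

theorem shift_eq (h : H) :
    shift f h = WithConv.toConv ((LinearMap.toSpanSingleton k H 1) ∘ₗ f.ofConv ∘ₗ
      LinearMap.mulLeft k h) * WithConv.toConv (HopfAlgebraStruct.antipode k) := by
  rw [← hf.shift_mul_id, mul_assoc, LinearMap.id_mul_antipode, mul_one]

theorem shift_apply_eq (h x : H) : (shift f h).ofConv x = ∑ i ∈ (ℛ k x).index,
    f.ofConv (h * (ℛ k x).left i) • HopfAlgebraStruct.antipode k ((ℛ k x).right i) := by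
  rw [hf.shift_eq]
  refine ((ℛ k x).convMul_apply _ _).trans ?_
  refine Finset.sum_congr rfl fun i _ => ?_
  change (f.ofConv (h * (ℛ k x).left i) • (1 : H)) * _ = _
  rw [smul_mul_assoc, one_mul]

theorem evalRight_mem {n : H} (hn : ∀ x, f.ofConv (n * x) = 0) (b : ConvDual k H) (x : H) :
    f.ofConv (evalRight b (CoalgebraStruct.comul (R := k) n) * x) = 0 := by
  rw [← ofConv_shift, hf.shift_apply_eq]
  simp [hn]

variable [FiniteDimensional k H]

theorem counit_eq_zero (h0 : f ≠ 0) {n : H} (hn : ∀ x, f.ofConv (n * x) = 0) :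
    Coalgebra.counit (R := k) n = 0 := by
  by_contra hne
  let β := Module.finBasis k H
  have hexp : ∀ z : H ⊗[k] H,
      z = ∑ i, evalRight (WithConv.toConv (β.coord i)) z ⊗ₜ[k] β i := by
    intro z
    induction z using TensorProduct.induction_on with
    | zero => simp
    | tmul x y =>
      conv_lhs => rw [← β.sum_repr y, TensorProduct.tmul_sum]
      simp [TensorProduct.smul_tmul']
    | add x y hx hy =>
      conv_lhs => rw [hx, hy]
      simp [TensorProduct.add_tmul, Finset.sum_add_distrib]
  have h1 := HopfAlgebra.mul_antipode_lTensor_comul_apply (R := k) n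
  rw [hexp (CoalgebraStruct.comul (R := k) n)] at h1
  simp only [map_sum, LinearMap.lTensor_tmul, LinearMap.mul'_apply] at h1
  apply h0
  apply ext_ofConv
  intro x
  have h2 : f.ofConv (algebraMap k H (Coalgebra.counit n) * x) = 0 := by
    rw [← h1, Finset.sum_mul, map_sum]
    refine Finset.sum_eq_zero fun i _ => ?_
    rw [mul_assoc]
    exact hf.evalRight_mem hn _ _
  rw [← Algebra.smul_def, map_smul, smul_eq_mul] at h2
  exact (mul_eq_zero.1 h2).resolve_left hne

theorem eq_zero_of_forall (h0 : f ≠ 0) {n : H} (hn : ∀ x, f.ofConv (n * x) = 0) : n = 0 := by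
  apply eq_of_forall_ofConv (k := k)
  intro b
  have h1 := hf.counit_eq_zero h0 (hf.evalRight_mem hn b)
  rw [map_zero, ← h1]
  have h2 := ofConv_evalRight (1 : ConvDual k H) b (CoalgebraStruct.comul (R := k) n)
  rw [← ofConv_mul, one_mul, ofConv_one] at h2
  exact h2.symm

theorem exists_smul_eq (h0 : f ≠ 0) {f' : ConvDual k H} (hf' : IsRightIntegral f') :
    ∃ c : k, f' = c • f := by
  let L : H →ₗ[k] ConvDual k H :=
    { toFun := fun h => WithConv.toConv (f.ofConv ∘ₗ LinearMap.mulLeft k h)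
      map_add' := fun x y => ext_ofConv fun z => by simp [add_mul]
      map_smul' := fun c x => ext_ofConv fun z => by simp }
  have hinj : Function.Injective L := by
    rw [← LinearMap.ker_eq_bot, LinearMap.ker_eq_bot']
    intro n hn
    exact hf.eq_zero_of_forall h0 fun x => congrArg (fun a => a.ofConv x) hn
  obtain ⟨h, rfl⟩ := (LinearMap.injective_iff_surjective_of_finrank_eq_finrank
    finrank_convDual.symm).1 hinj f'
  have hLh : ∀ x, (L h).ofConv x = f.ofConv (h * x) := fun _ => rfl
  have hsh : ∀ x, (shift f h).ofConv x = f.ofConv (h * x) • 1 := by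
    intro x
    have h1 := congrArg (HopfAlgebraStruct.antipode k) (hf' x)
    rw [← (ℛ k x).eq, hLh, map_smul, HopfAlgebra.antipode_one] at h1
    rw [hf.shift_apply_eq, ← h1]
    simp [hLh]
  have hb : ∀ b : ConvDual k H,
      evalRight b (CoalgebraStruct.comul (R := k) h) = b.ofConv 1 • h := by
    intro b
    rw [← sub_eq_zero]
    apply hf.eq_zero_of_forall h0
    intro x
    rw [sub_mul, map_sub, ← ofConv_shift, hsh]
    simp [mul_comm]
  have hh : h = Coalgebra.counit (R := k) h • (1 : H) := by
    apply eq_of_forall_ofConv (k := k)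
    intro b
    have h2 := ofConv_evalRight (1 : ConvDual k H) b (CoalgebraStruct.comul (R := k) h)
    rw [← ofConv_mul, one_mul, hb, ofConv_one] at h2
    rw [← h2]
    simp [mul_comm]
  refine ⟨Coalgebra.counit (R := k) h, ext_ofConv fun x => ?_⟩
  rw [hLh]
  nth_rw 1 [hh]
  simp

theorem eq_zero_of_mul_eq {e : ConvDual k H} (hef : e * f = f)
    (he : ∀ g : GroupLike k H, e.ofConv g.val = 0) : f = 0 := by
  by_contra h0
  rw [isRightIntegral_iff] at hf
  have hex : ∀ a : ConvDual k H, ∃ c : k, a * f = c • f := fun a =>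
    (isRightIntegral_iff.2 hf).exists_smul_eq h0 (isRightIntegral_iff.2 fun b => by
      rw [mul_assoc, hf, mul_smul_comm])
  choose θ hθ using hex
  have hinj : ∀ {c c' : k}, c • f = c' • f → c = c' := fun h => smul_left_injective k h0 h
  let Θ : ConvDual k H →ₐ[k] k := AlgHom.ofLinearMap
    { toFun := θ
      map_add' := fun a b => hinj (by rw [← hθ, add_mul, hθ, hθ, add_smul])
      map_smul' := fun c a => hinj (by
        rw [← hθ, smul_mul_assoc, hθ, smul_smul]; rfl) }
    (hinj (by change θ 1 • f = _; rw [← hθ, one_mul, one_smul]))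
    (fun a b => hinj (by
      change θ (a * b) • f = (θ a * θ b) • f
      rw [← hθ, mul_assoc, hθ, mul_smul_comm, hθ, smul_smul, mul_comm]))
  obtain ⟨g, hg, hΘ⟩ := exists_isGroupLikeElem Θ
  have h1 : θ e = 0 := (hΘ e).trans (he ⟨g, hg⟩)
  rw [hθ, h1, zero_smul] at hef
  exact h0 hef.symm

end IsRightIntegral

/-- An eigenvector for right multiplication cannot lie in `e A` if `e` vanishes on all grouplike
elements. -/
theorem eq_zero_of_forall_mul_eq [FiniteDimensional k H] {e f : ConvDual k H} (g : GroupLike k H)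
    (hf : ∀ a : ConvDual k H, f * a = a.ofConv g.val • f) (hef : e * f = f)
    (he : ∀ g : GroupLike k H, e.ofConv g.val = 0) : f = 0 := by
  have h1 : IsRightIntegral (leftTr g f) := by
    rw [isRightIntegral_iff]
    intro a
    obtain ⟨a, rfl⟩ := (leftTr g).surjective a
    rw [← map_mul, hf, map_smul, leftTr_apply, mul_one]
  have h2 : leftTr g f = 0 := h1.eq_zero_of_mul_eq (e := leftTr g e)
    (by rw [← map_mul, hef]) (fun h => by rw [leftTr_apply, ← GroupLike.val_mul, he])
  exact (map_eq_zero_iff _ (leftTr g).injective).1 h2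

end Integral

namespace CoradData

variable {k H : Type*} [Field k] [Ring H] [HopfAlgebra k H] [Fintype (GroupLike k H)]
  [DecidableEq (GroupLike k H)] {V : Type*} [Fintype V] [DecidableEq V] {d : V → ℕ}
  (B : CoradData k H d) [∀ v, NeZero (d v)] [CharZero k] [FiniteDimensional k H]

theorem rk_ne_succ (v : V) : B.rk (Sum.inr v) ≠ d v + 1 := by
  intro h
  obtain ⟨f, h0, hfE, θ, hθ⟩ := B.exists_eigenvector ⟨Sum.inr v, 0⟩ h
  obtain ⟨g, hg, hΘ⟩ := exists_isGroupLikeElem θ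
  refine h0 (eq_zero_of_forall_mul_eq ⟨g, hg⟩ (fun a => ?_) hfE fun g => ?_)
  · rw [hθ, hΘ]
  · exact (B.coef_val _ _).trans (if_neg Sum.inr_ne_inl)

end CoradData

section SkewPrimitive

variable {k H : Type*} [Field k] [Ring H] [HopfAlgebra k H]

/-- The functional `f(x ·)`. -/
noncomputable def leftMulTr (x : H) (f : ConvDual k H) : ConvDual k H :=
  WithConv.toConv (f.ofConv ∘ₗ LinearMap.mulLeft k x)

@[simp] theorem leftMulTr_apply (x y : H) (f : ConvDual k H) :
    (leftMulTr x f).ofConv y = f.ofConv (x * y) := rfl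

theorem evalRight_tmul_mul (f : ConvDual k H) (u w : H) (z : H ⊗[k] H) :
    evalRight f (u ⊗ₜ w * z) = u * evalRight (leftMulTr w f) z := by
  induction z using TensorProduct.induction_on with
  | zero => simp
  | tmul x y => simp
  | add x y hx hy => simp [mul_add, hx, hy]

theorem evalLeft_tmul_mul (f : ConvDual k H) (u w : H) (z : H ⊗[k] H) :
    evalLeft f (u ⊗ₜ w * z) = w * evalLeft (leftMulTr u f) z := by
  induction z using TensorProduct.induction_on with
  | zero => simp
  | tmul x y => simp
  | add x y hx hy => simp [mul_add, hx, hy]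

theorem leftMulTr_one (f : ConvDual k H) : leftMulTr 1 f = f :=
  ext_ofConv fun x => by simp

/-- The span of the elements `x ^ i * g` with `i < n` and `g` grouplike. -/
def powSpan (k : Type*) {H : Type*} [Field k] [Ring H] [HopfAlgebra k H] (x : H) (n : ℕ) :
    Submodule k H :=
  Submodule.span k {y | ∃ i < n, ∃ g : GroupLike k H, y = x ^ i * g.val}

theorem pow_mul_mem_powSpan (x : H) {i n : ℕ} (h : i < n) (g : GroupLike k H) :
    x ^ i * g.val ∈ powSpan k x n :=
  Submodule.subset_span ⟨i, h, g, rfl⟩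

theorem powSpan_mono (x : H) {m n : ℕ} (h : m ≤ n) : powSpan k x m ≤ powSpan k x n :=
  Submodule.span_mono fun _ ⟨i, hi, g, hy⟩ => ⟨i, hi.trans_le h, g, hy⟩

theorem mul_mem_powSpan (x : H) {n : ℕ} {y : H} (hy : y ∈ powSpan k x n) :
    x * y ∈ powSpan k x (n + 1) := by
  suffices h : powSpan k x n ≤ (powSpan k x (n + 1)).comap (LinearMap.mulLeft k x) from h hy
  rw [powSpan, Submodule.span_le]
  rintro _ ⟨i, hi, g, rfl⟩
  change x * (x ^ i * g.val) ∈ powSpan k x (n + 1)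
  rw [← mul_assoc, ← pow_succ']
  exact pow_mul_mem_powSpan x (by omega) g

/-- A skew primitive element which is an eigenvector for its grouplike element. -/
structure IsSkewEigen (c : GroupLike k H) (x : H) (q : k) : Prop where
  comul : CoalgebraStruct.comul (R := k) x = x ⊗ₜ[k] 1 + c.val ⊗ₜ[k] x
  comm : c.val * x = q • (x * c.val)

namespace IsSkewEigen

variable {c : GroupLike k H} {x : H} {q : k} (hx : IsSkewEigen c x q)
include hx

theorem val_mul_pow (n : ℕ) : c.val * x ^ n = q ^ n • (x ^ n * c.val) := by
  induction n with
  | zero => simp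
  | succ n ih =>
    rw [pow_succ, ← mul_assoc, ih, smul_mul_assoc, mul_assoc, hx.comm, mul_smul_comm, smul_smul,
      ← mul_assoc, pow_succ]

theorem val_mul_mem {n : ℕ} {y : H} (hy : y ∈ powSpan k x n) : c.val * y ∈ powSpan k x n := by
  suffices h : powSpan k x n ≤ (powSpan k x n).comap (LinearMap.mulLeft k c.val) from h hy
  refine Submodule.span_le.2 ?_
  rintro _ ⟨i, hi, g, rfl⟩
  change c.val * (x ^ i * g.val) ∈ powSpan k x n
  rw [← mul_assoc, hx.val_mul_pow, smul_mul_assoc, mul_assoc, ← GroupLike.val_mul]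
  exact Submodule.smul_mem _ _ (pow_mul_mem_powSpan x hi _)

theorem evalRight_comul_mul (f : ConvDual k H) (y : H) :
    evalRight f (CoalgebraStruct.comul (R := k) (x * y)) =
      x * evalRight f (CoalgebraStruct.comul (R := k) y) +
        c.val * evalRight (leftMulTr x f) (CoalgebraStruct.comul (R := k) y) := by
  rw [Bialgebra.comul_mul, hx.comul, add_mul, map_add, evalRight_tmul_mul, evalRight_tmul_mul,
    leftMulTr_one]

theorem evalLeft_comul_mul (f : ConvDual k H) (y : H) :
    evalLeft f (CoalgebraStruct.comul (R := k) (x * y)) =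
      evalLeft (leftMulTr x f) (CoalgebraStruct.comul (R := k) y) +
        x * evalLeft (leftMulTr c.val f) (CoalgebraStruct.comul (R := k) y) := by
  rw [Bialgebra.comul_mul, hx.comul, add_mul, map_add, evalLeft_tmul_mul, evalLeft_tmul_mul,
    one_mul]

theorem evalLeft_pow_mul (n : ℕ) (f : ConvDual k H) (g : GroupLike k H) :
    evalLeft f (CoalgebraStruct.comul (R := k) (x ^ n * g.val)) -
      f.ofConv (c.val ^ n * g.val) • (x ^ n * g.val) ∈ powSpan k x n := by
  induction n generalizing f with
  | zero => simp [g.isGroupLikeElem_val.comul_eq_tmul_self]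
  | succ n ih =>
    rw [pow_succ', mul_assoc, hx.evalLeft_comul_mul]
    have h1 := mul_mem_powSpan x (ih (leftMulTr c.val f))
    have h2 : evalLeft (leftMulTr x f) (CoalgebraStruct.comul (R := k) (x ^ n * g.val)) ∈
        powSpan k x (n + 1) := by
      rw [← sub_add_cancel (evalLeft (leftMulTr x f) _)
        ((leftMulTr x f).ofConv (c.val ^ n * g.val) • (x ^ n * g.val))]
      exact Submodule.add_mem _ (powSpan_mono x n.le_succ (ih _))
        (Submodule.smul_mem _ _ (pow_mul_mem_powSpan x n.lt_succ_self g))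
    convert Submodule.add_mem _ h2 h1 using 1
    rw [mul_sub, mul_smul_comm, leftMulTr_apply, add_sub_assoc, pow_succ', mul_assoc]

theorem evalRight_pow_mul (n : ℕ) (f : ConvDual k H) (g : GroupLike k H) :
    evalRight f (CoalgebraStruct.comul (R := k) (x ^ (n + 1) * g.val)) -
      (f.ofConv g.val • (x ^ (n + 1) * g.val) +
        ((∑ i ∈ Finset.range (n + 1), q ^ i) * f.ofConv (x * g.val)) •
          (x ^ n * (c * g).val)) ∈ powSpan k x n := by
  induction n generalizing f with
  | zero =>
    rw [pow_one, hx.evalRight_comul_mul, g.isGroupLikeElem_val.comul_eq_tmul_self]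
    simp
  | succ n ih =>
    rw [pow_succ' x (n + 1), mul_assoc, hx.evalRight_comul_mul]
    have h1 := mul_mem_powSpan x (ih f)
    have h2 := hx.val_mul_mem (ih (leftMulTr x f))
    have h3 : c.val * (((∑ i ∈ Finset.range (n + 1), q ^ i) * f.ofConv (x * (x * g.val))) •
        (x ^ n * (c * g).val)) ∈ powSpan k x (n + 1) :=
      hx.val_mul_mem (Submodule.smul_mem _ _ (pow_mul_mem_powSpan x n.lt_succ_self _))
    have h4 : c.val * (x ^ (n + 1) * g.val) = q ^ (n + 1) • (x ^ (n + 1) * (c * g).val) := by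
      rw [← mul_assoc, hx.val_mul_pow, smul_mul_assoc, mul_assoc, ← GroupLike.val_mul]
    convert Submodule.add_mem _ (Submodule.add_mem _ h1 (powSpan_mono x n.le_succ h2)) h3 using 1
    simp only [mul_sub, mul_add, mul_smul_comm, leftMulTr_apply, h4, ← mul_assoc x (x ^ n) _,
      ← pow_succ', Finset.sum_range_succ _ (n + 1), add_mul, add_smul, smul_smul]
    rw [mul_comm (q ^ (n + 1))]
    abel

theorem evalRight_mem_powSpan {f : ConvDual k H} (hf : ∀ g : GroupLike k H, f.ofConv g.val = 0)
    {n : ℕ} {y : H} (hy : y ∈ powSpan k x (n + 1)) :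
    evalRight f (CoalgebraStruct.comul (R := k) y) ∈ powSpan k x n := by
  suffices h : powSpan k x (n + 1) ≤ (powSpan k x n).comap
    (evalRight f ∘ₗ CoalgebraStruct.comul (R := k)) from h hy
  refine Submodule.span_le.2 ?_
  rintro _ ⟨i, hi, g, rfl⟩
  change evalRight f (CoalgebraStruct.comul (R := k) (x ^ i * g.val)) ∈ powSpan k x n
  rcases i with _ | i
  · simp [g.isGroupLikeElem_val.comul_eq_tmul_self, hf]
  · have h1 := hx.evalRight_pow_mul i f g
    rw [hf, zero_smul, zero_add] at h1
    have h2 := Submodule.add_mem _ (powSpan_mono (n := n) x (by omega) h1) (Submodule.smul_mem _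
      ((∑ i ∈ Finset.range (i + 1), q ^ i) * f.ofConv (x * g.val))
      (pow_mul_mem_powSpan x (by omega : i < n) (c * g)))
    rwa [sub_add_cancel] at h2

theorem eq_zero_of_sum_mem [Fintype (GroupLike k H)]
    (hxG : x ∉ Submodule.span k (Set.range (GroupLike.val (R := k) (A := H))))
    (n : ℕ) (hq : ∀ m < n, ∑ i ∈ Finset.range (m + 1), q ^ i ≠ 0) (α : GroupLike k H → k)
    (hα : ∑ g, α g • (x ^ n * g.val) ∈ powSpan k x n) (g : GroupLike k H) : α g = 0 := by
  induction n generalizing α g with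
  | zero =>
    have h1 : powSpan k x 0 = ⊥ := by simp [powSpan]
    rw [h1, Submodule.mem_bot] at hα
    simp only [pow_zero, one_mul] at hα
    exact Fintype.linearIndependent_iff.1 (linearIndep_groupLikeVal (R := k) (A := H)) α hα g
  | succ n ih =>
    have hxg : x * g.val ∉ Submodule.span k (Set.range (GroupLike.val (R := k) (A := H))) := by
      intro h
      apply hxG
      have h1 : Submodule.span k (Set.range (GroupLike.val (R := k) (A := H))) ≤
          (Submodule.span k (Set.range (GroupLike.val (R := k) (A := H)))).comap
            (LinearMap.mulRight k (g⁻¹).val) := by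
        rw [Submodule.span_le]
        rintro _ ⟨h, rfl⟩
        exact (Submodule.subset_span ⟨h * g⁻¹, GroupLike.val_mul _ _⟩ : h.val * (g⁻¹).val ∈
          Submodule.span k (Set.range (GroupLike.val (R := k) (A := H))))
      have h2 : x * g.val * (g⁻¹).val ∈
          Submodule.span k (Set.range (GroupLike.val (R := k) (A := H))) := h1 h
      rwa [mul_assoc, ← GroupLike.val_mul, mul_inv_cancel, GroupLike.val_one, mul_one] at h2
    obtain ⟨f, hf0, hf⟩ := Submodule.exists_le_ker_of_notMem hxg
    let F : ConvDual k H := WithConv.toConv f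
    have hF : ∀ g : GroupLike k H, F.ofConv g.val = 0 := fun g =>
      hf (Submodule.subset_span ⟨g, rfl⟩)
    have h1 := hx.evalRight_mem_powSpan hF hα
    have h2 : ∑ h, α h • (evalRight F (CoalgebraStruct.comul (R := k) (x ^ (n + 1) * h.val)) -
        ((∑ i ∈ Finset.range (n + 1), q ^ i) * F.ofConv (x * h.val)) •
          (x ^ n * (c * h).val)) ∈ powSpan k x n := by
      refine Submodule.sum_mem _ fun h _ => Submodule.smul_mem _ _ ?_
      have h3 := hx.evalRight_pow_mul n F h
      rwa [hF, zero_smul, zero_add] at h3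
    have h3 := Submodule.sub_mem _ h1 h2
    simp only [map_sum, map_smul, smul_sub, Finset.sum_sub_distrib, sub_sub_cancel, smul_smul]
      at h3
    have h4 := ih (fun m hm => hq m (by omega)) (fun h => α (c⁻¹ * h) *
      ((∑ i ∈ Finset.range (n + 1), q ^ i) * F.ofConv (x * (c⁻¹ * h).val))) (by
        rw [← Equiv.sum_comp (Equiv.mulLeft c)]
        simpa only [Equiv.coe_mulLeft, inv_mul_cancel_left] using h3) (c * g)
    simp only [inv_mul_cancel_left] at h4
    rcases mul_eq_zero.1 h4 with h | h
    · exact h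
    · rcases mul_eq_zero.1 h with h | h
      · exact absurd h (hq n n.lt_succ_self)
      · exact absurd h hf0

theorem le_finrank [Fintype (GroupLike k H)] [FiniteDimensional k H]
    (hxG : x ∉ Submodule.span k (Set.range (GroupLike.val (R := k) (A := H))))
    {p : ℕ} (hq : ∀ m, m + 1 < p → ∑ i ∈ Finset.range (m + 1), q ^ i ≠ 0)
    {e : ConvDual k H} (he : e * e = e) {g : GroupLike k H} (heg : e.ofConv g.val = 1) :
    p ≤ Module.finrank k (LinearMap.range (LinearMap.mulLeft k e)) := by
  let D : H →ₗ[k] H := evalLeft e ∘ₗ CoalgebraStruct.comul (R := k)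
  have hD : ∀ (a : ConvDual k H) y, a.ofConv (D y) = (e * a).ofConv y := fun a y => by
    rw [ofConv_mul, ← ofConv_evalLeft]
    rfl
  let E := LinearMap.range D
  have hE : ∀ m ≤ p, m ≤ Module.finrank k (E ⊓ powSpan k x m : Submodule k H) := by
    intro m hm
    induction m with
    | zero => exact Nat.zero_le _
    | succ m ih =>
      refine (ih (by omega)).trans_lt (Submodule.finrank_lt_finrank_of_lt ?_)
      refine lt_of_le_of_ne (inf_le_inf_left _ (powSpan_mono x m.le_succ)) fun heq => ?_
      let h : GroupLike k H := c⁻¹ ^ m * g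
      have h1 := hx.evalLeft_pow_mul m e h
      have h2 : c.val ^ m * h.val = g.val := by
        rw [← GroupLike.val_pow, ← GroupLike.val_mul]
        exact congrArg _ (by simp [h])
      rw [h2, heg, one_smul] at h1
      have h3 : D (x ^ m * h.val) ∈ E ⊓ powSpan k x (m + 1) := by
        refine ⟨⟨_, rfl⟩, ?_⟩
        have := Submodule.add_mem _ (powSpan_mono x m.le_succ h1)
          (pow_mul_mem_powSpan x m.lt_succ_self h)
        rwa [sub_add_cancel] at this
      rw [← heq] at h3
      have h4 := Submodule.sub_mem _ h3.2 h1
      rw [show D (x ^ m * h.val) = evalLeft e (CoalgebraStruct.comul (R := k) (x ^ m * h.val))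
        from rfl, sub_sub_cancel] at h4
      classical
      have h5 := hx.eq_zero_of_sum_mem hxG m (fun i hi => hq i (by omega))
        (fun h' => if h' = h then 1 else 0) (by simpa using h4) h
      simp at h5
  have h1 : p ≤ Module.finrank k E := (hE p le_rfl).trans (Submodule.finrank_mono inf_le_left)
  let R : LinearMap.range (LinearMap.mulLeft k e) →ₗ[k] Module.Dual k E :=
    { toFun := fun a => a.1.ofConv ∘ₗ E.subtype
      map_add' := fun _ _ => rfl
      map_smul' := fun _ _ => rfl }
  have hR : Function.Surjective R := by
    intro u
    obtain ⟨a, ha⟩ := LinearMap.exists_extend u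
    refine ⟨⟨e * WithConv.toConv a, ⟨WithConv.toConv a, rfl⟩⟩, ?_⟩
    rw [← ha]
    ext ⟨_, y, rfl⟩
    change (e * WithConv.toConv a).ofConv (D y) = a (D y)
    rw [← hD, show a (D y) = (WithConv.toConv a).ofConv (D y) from rfl, hD, hD, hD, ← mul_assoc,
      he]
  rw [← Subspace.dual_finrank_eq] at h1
  exact h1.trans (LinearMap.finrank_le_finrank_of_surjective hR)

end IsSkewEigen

end SkewPrimitive

section Eigen

variable {k : Type*} [Field k]

theorem exists_eigenvector_notMem [IsAlgClosed k] [CharZero k] {W : Type*} [AddCommGroup W]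
    [Module k W] [FiniteDimensional k W] {T : Module.End k W} {n : ℕ} (hn : n ≠ 0)
    (hT : T ^ n = 1) {U : Submodule k W} {x : W} (hx : x ∉ U) :
    ∃ q : k, ∃ y ∉ U, T y = q • y := by
  by_contra! hcon
  have hsq : Squarefree (Polynomial.X ^ n - 1 : Polynomial k) :=
    (Polynomial.separable_X_pow_sub_C (1 : k) (Nat.cast_ne_zero.2 hn) one_ne_zero).squarefree
  have hss : T.IsSemisimple := Module.End.isSemisimple_of_squarefree_aeval_eq_zero hsq (by
    simp [hT])
  have h1 := Module.End.iSup_maxGenEigenspace_eq_top T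
  simp only [hss.isFinitelySemisimple.maxGenEigenspace_eq_eigenspace] at h1
  have h2 : (⨆ μ, Module.End.eigenspace T μ) ≤ U := iSup_le fun μ y hy => by
    by_contra h
    exact hcon μ y h (Module.End.mem_eigenspace_iff.1 hy)
  rw [h1] at h2
  exact hx (h2 trivial)

theorem sum_pow_ne_zero [CharZero k] {p : ℕ} (hp : p.Prime) {q : k} (hq : q ^ p = 1) (m : ℕ)
    (hm : m + 1 < p) : ∑ i ∈ Finset.range (m + 1), q ^ i ≠ 0 := by
  intro h
  have h1 := geom_sum_mul q (m + 1)
  rw [h, zero_mul, eq_comm, sub_eq_zero] at h1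
  have h2 : orderOf q ∣ 1 := by
    rw [← ((hp.coprime_iff_not_dvd.2 fun h =>
      absurd (Nat.le_of_dvd m.succ_pos h) (by omega)).symm : Nat.gcd (m + 1) p = 1)]
    exact Nat.dvd_gcd (orderOf_dvd_of_pow_eq_one h1) (orderOf_dvd_of_pow_eq_one hq)
  rw [Nat.dvd_one, orderOf_eq_one_iff] at h2
  rw [h2] at h
  simp only [one_pow, Finset.sum_const, Finset.card_range, nsmul_eq_mul, mul_one] at h
  exact Nat.cast_ne_zero.2 m.succ_ne_zero h

variable {H : Type*} [Ring H] [HopfAlgebra k H]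

theorem exists_isSkewEigen [IsAlgClosed k] [CharZero k] [FiniteDimensional k H]
    {p : ℕ} (hp : p ≠ 0) (hcard : Nat.card (GroupLike k H) = p) {g h : GroupLike k H} {x : H}
    (hx : CoalgebraStruct.comul (R := k) x = g.val ⊗ₜ[k] x + x ⊗ₜ[k] h.val)
    (hxG : x ∉ Submodule.span k (Set.range (GroupLike.val (R := k) (A := H)))) :
    ∃ c : GroupLike k H, ∃ y : H, ∃ q : k, IsSkewEigen c y q ∧ q ^ p = 1 ∧
      y ∉ Submodule.span k (Set.range (GroupLike.val (R := k) (A := H))) := by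
  let U := Submodule.span k (Set.range (GroupLike.val (R := k) (A := H)))
  let c : GroupLike k H := h⁻¹ * g
  let L : H →ₗ[k] H ⊗[k] H := CoalgebraStruct.comul (R := k) -
    (TensorProduct.mk k H H).flip 1 - TensorProduct.mk k H H c.val
  have hL : ∀ y, y ∈ LinearMap.ker L ↔
      CoalgebraStruct.comul (R := k) y = y ⊗ₜ[k] 1 + c.val ⊗ₜ[k] y := fun y => by
    rw [LinearMap.mem_ker, ← sub_eq_zero (a := CoalgebraStruct.comul (R := k) y), ← sub_sub]
    rfl
  have hval : ∀ a b : GroupLike k H, a * b = 1 → a.val * b.val = 1 := fun a b hab => by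
    rw [← GroupLike.val_mul, hab, GroupLike.val_one]
  let T : H →ₗ[k] H := LinearMap.mulLeft k c.val ∘ₗ LinearMap.mulRight k (c⁻¹).val
  have hTL : ∀ y ∈ LinearMap.ker L, T y ∈ LinearMap.ker L := by
    intro y hy
    rw [hL] at hy ⊢
    change CoalgebraStruct.comul (R := k) (c.val * (y * (c⁻¹).val)) =
      (c.val * (y * (c⁻¹).val)) ⊗ₜ 1 + c.val ⊗ₜ (c.val * (y * (c⁻¹).val))
    rw [Bialgebra.comul_mul, Bialgebra.comul_mul, hy, c.isGroupLikeElem_val.comul_eq_tmul_self,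
      (c⁻¹).isGroupLikeElem_val.comul_eq_tmul_self, add_mul, mul_add]
    simp only [Algebra.TensorProduct.tmul_mul_tmul, one_mul, hval c c⁻¹ (mul_inv_cancel c), mul_one]
  have hTpow : ∀ n y, (T ^ n) y = (c ^ n).val * (y * (c⁻¹ ^ n).val) := by
    intro n y
    induction n with
    | zero => simp
    | succ n ih =>
      rw [pow_succ', Module.End.mul_apply, ih, pow_succ' c, pow_succ c⁻¹,
        GroupLike.val_mul c, GroupLike.val_mul (c⁻¹ ^ n)]
      change c.val * (_ * (c⁻¹).val) = _
      simp only [mul_assoc]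
  have hcp : ∀ a : GroupLike k H, a ^ p = 1 := fun a => by rw [← hcard, pow_card_eq_one']
  have hT1 : (T.restrict hTL) ^ p = 1 := by
    rw [Module.End.pow_restrict]
    ext y
    change (T ^ p) y.1 = y.1
    rw [hTpow, hcp, hcp, GroupLike.val_one, one_mul, mul_one]
  have hx0 : (h⁻¹).val * x ∈ LinearMap.ker L := by
    rw [hL, Bialgebra.comul_mul, hx, (h⁻¹).isGroupLikeElem_val.comul_eq_tmul_self, mul_add]
    simp only [Algebra.TensorProduct.tmul_mul_tmul, hval _ _ (inv_mul_cancel h), c,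
      GroupLike.val_mul]
    rw [add_comm]
  have hx1 : (h⁻¹).val * x ∉ U := by
    intro hU
    apply hxG
    have h1 : U ≤ U.comap (LinearMap.mulLeft k h.val) := by
      rw [Submodule.span_le]
      rintro _ ⟨a, rfl⟩
      exact (Submodule.subset_span ⟨h * a, GroupLike.val_mul _ _⟩ : h.val * a.val ∈ U)
    have h2 : h.val * ((h⁻¹).val * x) ∈ U := h1 hU
    rwa [← mul_assoc, hval _ _ (mul_inv_cancel h), one_mul] at h2
  obtain ⟨q, y, hyU, hy⟩ := exists_eigenvector_notMem (U := U.comap (LinearMap.ker L).subtype)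
    hp hT1 (x := ⟨_, hx0⟩) hx1
  have hTy : T y.1 = q • y.1 := congrArg Subtype.val hy
  refine ⟨c, y.1, q, ⟨(hL _).1 y.2, ?_⟩, ?_, hyU⟩
  · have h1 : c.val * (y.1 * (c⁻¹).val) = q • y.1 := hTy
    rw [← smul_mul_assoc, ← h1, mul_assoc, mul_assoc, hval _ _ (inv_mul_cancel c), mul_one]
  · have h1 : ∀ n, (T ^ n) y.1 = q ^ n • y.1 := by
      intro n
      induction n with
      | zero => simp
      | succ n ih => rw [pow_succ, Module.End.mul_apply, hTy, map_smul, ih, smul_smul, pow_succ']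
    have h2 := h1 p
    rw [hTpow, hcp, hcp, GroupLike.val_one, one_mul, mul_one] at h2
    have h3 : (q ^ p - 1) • y.1 = 0 := by rw [sub_smul, ← h2, one_smul, sub_self]
    rcases smul_eq_zero.1 h3 with h3 | h3
    · exact sub_eq_zero.1 h3
    · exact absurd (by rw [Submodule.mem_comap, Submodule.subtype_apply, h3]; exact zero_mem U) hyU

end Eigen

namespace CoradData

variable {k H : Type*} [Field k] [Ring H] [HopfAlgebra k H] [Fintype (GroupLike k H)]
  [DecidableEq (GroupLike k H)] {V : Type*} [Fintype V] [DecidableEq V] {d : V → ℕ}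
  (B : CoradData k H d)

theorem φ_inl (a : ConvDual k H) (g : GroupLike k H) :
    B.φ a (Sum.inl g) = a.ofConv g.val • 1 := by
  ext i j
  have hij : j = i := Subsingleton.elim (α := Fin 1) j i
  rw [B.φ_apply, B.mat_inl, hij, Matrix.smul_apply, Matrix.one_apply_eq,
    smul_eq_mul, mul_one]

variable [∀ v, NeZero (d v)]

theorem φ_coef_inl (g : GroupLike k H) :
    B.φ (B.coef (Sum.inl g)) = Pi.single (Sum.inl g) 1 := by
  rw [coef, B.φ_e]
  congr 1
  ext i j
  have hi : i = 0 := Subsingleton.elim (α := Fin 1) i 0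
  have hj : j = 0 := Subsingleton.elim (α := Fin 1) j 0
  rw [hi, hj, Matrix.single_apply_same, Matrix.one_apply_eq]

theorem mul_φ_coef (b : ConvDual k H) (g : GroupLike k H) :
    B.φ b * B.φ (B.coef (Sum.inl g)) = b.ofConv g.val • B.φ (B.coef (Sum.inl g)) := by
  rw [φ_coef_inl]
  funext S
  rw [Pi.mul_apply, Pi.smul_apply]
  by_cases h : S = Sum.inl g
  · subst h
    rw [Pi.single_eq_same, B.φ_inl, mul_one]
  · rw [Pi.single_eq_of_ne h, mul_zero, smul_zero]

theorem φ_coef_mul (b : ConvDual k H) (g : GroupLike k H) :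
    B.φ (B.coef (Sum.inl g)) * B.φ b = b.ofConv g.val • B.φ (B.coef (Sum.inl g)) := by
  rw [φ_coef_inl]
  funext S
  rw [Pi.mul_apply, Pi.smul_apply]
  by_cases h : S = Sum.inl g
  · subst h
    rw [Pi.single_eq_same, B.φ_inl, one_mul]
  · rw [Pi.single_eq_of_ne h, zero_mul, smul_zero]

theorem φ_leftTr_coef (g h : GroupLike k H) :
    B.φ (leftTr g (B.coef (Sum.inl h))) = B.φ (B.coef (Sum.inl (g⁻¹ * h))) := by
  have h1 : ∀ b : ConvDual k H, B.φ b * B.φ (leftTr g (B.coef (Sum.inl h))) =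
      b.ofConv (g⁻¹ * h).val • B.φ (leftTr g (B.coef (Sum.inl h))) := by
    intro b
    obtain ⟨a, rfl⟩ := (leftTr g).surjective b
    rw [leftTr_apply, ← GroupLike.val_mul, mul_inv_cancel_left, ← map_mul, ← map_smul, ← map_mul,
      ← map_smul, ← sub_eq_zero, ← map_sub, ← map_sub]
    refine B.map_mem_radical (leftTr g) ?_
    rw [B.mem_radical, map_sub, map_mul, map_smul, mul_φ_coef, sub_self]
  have h2 := h1 (B.coef (Sum.inl (g⁻¹ * h)))
  rw [φ_coef_mul, coef_val, if_pos rfl, one_smul, leftTr_apply, ← GroupLike.val_mul,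
    mul_inv_cancel_left, coef_val, if_pos rfl, one_smul] at h2
  exact h2.symm

/-- A corner of the radical between grouplike idempotents which is not contained in the square of
the radical gives a nontrivial skew primitive element. -/
theorem exists_skewPrimitive [FiniteDimensional k H] {y : ConvDual k H} (hy : y ∈ B.radical)
    {g h : GroupLike k H}
    (hne : B.coef (Sum.inl g) * y * B.coef (Sum.inl h) ∉ B.radical * B.radical) :
    ∃ x : H, CoalgebraStruct.comul (R := k) x = g.val ⊗ₜ[k] x + x ⊗ₜ[k] h.val ∧
      x ∉ Submodule.span k (Set.range (GroupLike.val (R := k) (A := H))) := by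
  obtain ⟨ξ, hξ, hker⟩ := Submodule.exists_le_ker_of_notMem hne
  set u := B.coef (Sum.inl g)
  set v := B.coef (Sum.inl h)
  let Y : ConvDual k H →ₗ[k] k := ξ ∘ₗ LinearMap.mulRight k v ∘ₗ LinearMap.mulLeft k u
  have hY : ∀ a, Y a = ξ (u * a * v) := fun a => rfl
  have hYmul : ∀ a b : ConvDual k H, Y (a * b) =
      a.ofConv g.val * Y b + Y a * b.ofConv h.val - a.ofConv g.val * b.ofConv h.val * Y 1 := by
    intro a b
    have h1 : u * a - a.ofConv g.val • u ∈ B.radical := by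
      rw [B.mem_radical, map_sub, map_mul, map_smul, φ_coef_mul, sub_self]
    have h2 : b * v - b.ofConv h.val • v ∈ B.radical := by
      rw [B.mem_radical, map_sub, map_mul, map_smul, mul_φ_coef, sub_self]
    have h3 := hker (Submodule.mul_mem_mul h1 h2)
    rw [LinearMap.mem_ker] at h3
    simp only [sub_mul, mul_sub, smul_mul_assoc, mul_smul_comm, map_sub, map_smul, smul_eq_mul]
      at h3
    simp only [hY, mul_one, ← mul_assoc] at h3 ⊢
    linear_combination h3
  let X : ConvDual k H →ₗ[k] k :=
    { toFun := fun a => Y a - Y 1 * a.ofConv g.val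
      map_add' := fun a b => by
        change Y (a + b) - Y 1 * (a.ofConv g.val + b.ofConv g.val) = _
        rw [map_add]
        ring
      map_smul' := fun r a => by
        change Y (r • a) - Y 1 * (r * a.ofConv g.val) = r * (Y a - Y 1 * a.ofConv g.val)
        rw [map_smul, smul_eq_mul]
        ring }
  obtain ⟨x, hx⟩ := exists_ofConv_eq X
  replace hx : ∀ a, a.ofConv x = Y a - Y 1 * a.ofConv g.val := fun a => (hx a).symm
  refine ⟨x, eq_of_forall_pair fun a b => ?_, fun hmem => ?_⟩
  · rw [← ofConv_mul, hx, hYmul, map_add, pair_tmul, pair_tmul, hx, hx, ofConv_mul,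
      g.isGroupLikeElem_val.comul_eq_tmul_self, pair_tmul]
    ring
  · have hyg : ∀ a : GroupLike k H, y.ofConv a.val = 0 := by
      intro a
      rw [← B.mat_inl a 0 0, ← B.φ_apply, B.mem_radical.1 hy]
      rfl
    have h1 : Submodule.span k (Set.range (GroupLike.val (R := k) (A := H))) ≤
        LinearMap.ker y.ofConv := by
      rw [Submodule.span_le]
      rintro _ ⟨a, rfl⟩
      exact hyg a
    have h2 : y.ofConv x = 0 := h1 hmem
    rw [hx, hyg, mul_zero, sub_zero] at h2
    exact hξ h2

theorem le_rk_inl [IsAlgClosed k] [CharZero k] [FiniteDimensional k H] {p : ℕ} (hp : p.Prime)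
    (hp3 : 3 ≤ p) (hd : ∀ v, p - 1 ≤ d v) (hcard : Fintype.card (GroupLike k H) = p)
    (hdim : Module.finrank k B.radical = p * (p - 2)) (g : GroupLike k H) :
    p ≤ B.rk (Sum.inl g) := by
  have hd1 : ∀ S, degrees (GroupLike k H) d S = 1 → ∃ h, S = Sum.inl h := by
    rintro (h | v) hS
    · exact ⟨h, rfl⟩
    · have := hd v
      simp only [degrees, Sum.elim_inr] at hS
      omega
  have hd2 : ∀ S, degrees (GroupLike k H) d S = 1 ∨ p - 1 ≤ degrees (GroupLike k H) d S := by
    rintro (h | v)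
    · exact Or.inl rfl
    · exact Or.inr (hd v)
  have hcard' : (Finset.univ.filter fun S => degrees (GroupLike k H) d S = 1).card = p := by
    rw [← hcard, ← Finset.card_univ, 
      ← Finset.card_map (s := Finset.univ)
        (Function.Embedding.inl : GroupLike k H ↪ GroupLike k H ⊕ V)]
    congr 1
    ext S
    simp only [Finset.mem_filter, Finset.mem_univ, true_and, Finset.mem_map,
      Function.Embedding.inl_apply]
    constructor
    · intro hS
      obtain ⟨h, rfl⟩ := hd1 S hS
      exact ⟨h, rfl⟩
    · rintro ⟨h, rfl⟩
      rfl
  have he : ∀ i : Σ S, Fin (degrees (GroupLike k H) d S),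
      degrees (GroupLike k H) d i.1 = 1 → ∃ h, B.e i = B.coef (Sum.inl h) := by
    rintro ⟨S, i⟩ hi
    obtain ⟨h, rfl⟩ := hd1 S hi
    refine ⟨h, ?_⟩
    rw [coef]
    congr 1
    exact congrArg (Sigma.mk (Sum.inl h)) (Subsingleton.elim (α := Fin 1) i 0)
  have htrans : ∀ i j : Σ S, Fin (degrees (GroupLike k H) d S),
      degrees (GroupLike k H) d i.1 = 1 → degrees (GroupLike k H) d j.1 = 1 →
      ∃ σ : ConvDual k H ≃ₐ[k] ConvDual k H, B.φ (σ (B.e i)) = B.φ (B.e j) := by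
    intro i j hi hj
    obtain ⟨a, ha⟩ := he i hi
    obtain ⟨b, hb⟩ := he j hj
    refine ⟨leftTr (a * b⁻¹), ?_⟩
    rw [ha, hb, φ_leftTr_coef, mul_inv_rev, inv_inv, inv_mul_cancel_right]
  have hbot : B.radical ≠ ⊥ := by
    intro h
    rw [h, finrank_bot] at hdim
    rcases Nat.mul_eq_zero.1 hdim.symm with h | h <;> omega
  obtain ⟨y, hy, i, j, hij⟩ := B.exists_corner_notMem_sq hbot
  have hne : B.e i * y * B.e j ≠ 0 := fun h => hij (h ▸ zero_mem _)
  obtain ⟨a, ha⟩ := he i (B.degree_one_of_corner_ne_zero' p hp3 hd2 hcard' htrans hdim hy i j hne)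
  obtain ⟨b, hb⟩ := he j (B.degree_one_of_corner_ne_zero p hp3 hd2 hcard' htrans hdim hy i j hne)
  rw [ha, hb] at hij
  obtain ⟨x, hx, hxG⟩ := B.exists_skewPrimitive hy hij
  obtain ⟨c, z, q, hz, hq, hzG⟩ := exists_isSkewEigen hp.ne_zero
    (by rw [Nat.card_eq_fintype_card, hcard]) hx hxG
  exact hz.le_finrank hzG (sum_pow_ne_zero hp hq) (B.coi.idem _)
    (by rw [coef_val, if_pos rfl])

end CoradData

theorem exists_linearMap_apply_eq {k M ι : Type*} [Field k] [AddCommGroup M] [Module k M]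
    {b : ι → M} (hb : LinearIndependent k b) (y : ι → k) : ∃ f : M →ₗ[k] k, ∀ i, f (b i) = y i := by
  obtain ⟨g, hg⟩ := LinearMap.exists_leftInverse_of_injective (Finsupp.linearCombination k b)
    (LinearMap.ker_eq_bot.2 hb)
  refine ⟨Finsupp.linearCombination k y ∘ₗ g, fun i => ?_⟩
  have h := LinearMap.congr_fun hg (Finsupp.single i 1)
  rw [LinearMap.comp_apply, Finsupp.linearCombination_single, one_smul, LinearMap.id_apply] at h
  rw [LinearMap.comp_apply, h, Finsupp.linearCombination_single, one_smul]

theorem numeric_cases {p s t r : ℕ} (hp : 3 ≤ p) (hs : 1 ≤ s)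
    (h : r + (p + s * p * ((p - 1) * (p - 1)) + t * (p * p)) = p ^ 3) :
    (s = 1 ∧ t = 0) ∨ (s = 1 ∧ t = 1 ∧ r = p * (p - 2)) ∨ (r = 0 ∧ t = 0) := by
  obtain ⟨q, rfl⟩ : ∃ q, p = q + 2 := ⟨p - 2, by omega⟩
  simp only [show q + 2 - 1 = q + 1 by omega, Nat.add_sub_cancel] at h ⊢
  have hs2 : s ≤ 2 := by
    by_contra hs2
    nlinarith [Nat.mul_le_mul_right ((q + 2) * ((q + 1) * (q + 1))) (show 3 ≤ s by omega),
      Nat.zero_le (t * ((q + 2) * (q + 2))), Nat.zero_le r, Nat.zero_le (q * q),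
      Nat.zero_le (q * q * q)]
  interval_cases s
  · have ht : t ≤ 1 := by
      by_contra ht
      nlinarith [Nat.mul_le_mul_right ((q + 2) * (q + 2)) (show 2 ≤ t by omega)]
    interval_cases t
    · simp
    · right; left
      refine ⟨rfl, rfl, ?_⟩
      nlinarith
  · right; right
    have hq : q = 1 := by
      by_contra hq
      nlinarith [Nat.mul_le_mul_right ((q + 2) * q) (show 2 ≤ q by omega),
        Nat.zero_le (t * ((q + 2) * (q + 2)))]
    subst hq
    omega

section Assembly

variable {k H : Type*} [Field k] [Ring H] [HopfAlgebra k H]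

theorem range_val_eq_grouplikes :
    Set.range (GroupLike.val (R := k) (A := H)) = grouplikes k H := by
  ext x
  constructor
  · rintro ⟨g, rfl⟩
    exact ⟨g.isGroupLikeElem_val.ne_zero, g.isGroupLikeElem_val.comul_eq_tmul_self⟩
  · rintro ⟨h0, hx⟩
    refine ⟨⟨x, ⟨?_, hx⟩⟩, rfl⟩
    have h1 := Coalgebra.rTensor_counit_comul (R := k) x
    rw [show CoalgebraStruct.comul (R := k) x = x ⊗ₜ x from hx, LinearMap.rTensor_tmul] at h1
    have h2 := congrArg (TensorProduct.lid k H) h1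
    rw [TensorProduct.lid_tmul, TensorProduct.lid_tmul, ← sub_eq_zero, ← sub_smul] at h2
    exact sub_eq_zero.1 ((smul_eq_zero.1 h2).resolve_right h0)

theorem isMulMat_grouplike (g : GroupLike k H) : IsMulMat k fun _ _ : Fin 1 => g.val :=
  ⟨fun _ _ => by simp [g.isGroupLikeElem_val.comul_eq_tmul_self],
    fun i j => by simp [g.isGroupLikeElem_val.counit_eq_one, Subsingleton.elim i j]⟩

variable [Fintype (GroupLike k H)] [DecidableEq (GroupLike k H)] {V : Type*} [Fintype V]
  [DecidableEq V] {d : V → ℕ}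

theorem exists_coradData [IsAlgClosed k] [FiniteDimensional k H] {U : V → Submodule k H}
    (hU : ∀ v, IsMatrixSubcoalg k H (d v) (U v))
    (hindep : iSupIndep fun i : Option V => i.elim (Submodule.span k (grouplikes k H)) U)
    (hsup : coradical k H = Submodule.span k (grouplikes k H) ⊔ ⨆ v, U v) :
    Nonempty (CoradData k H d) := by
  choose m hli hspan hcomul hcounit using hU
  let mat : ∀ S, Fin (degrees (GroupLike k H) d S) → Fin (degrees (GroupLike k H) d S) → H :=
    fun S => Sum.rec (motive := fun S => Fin (degrees (GroupLike k H) d S) →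
      Fin (degrees (GroupLike k H) d S) → H) (fun g _ _ => g.val) (fun v => m v) S
  have hmat : ∀ S, IsMulMat k (mat S) := by
    rintro (g | v)
    · exact isMulMat_grouplike g
    · exact ⟨hcomul v, hcounit v⟩
  let φ : ConvDual k H →ₐ[k] ∀ S, Matrix (Fin (degrees (GroupLike k H) d S))
      (Fin (degrees (GroupLike k H) d S)) k := AlgHom.pi fun S => (hmat S).hom
  have hφ : ∀ a S i j, φ a S i j = a.ofConv (mat S i j) := fun _ _ _ _ => rfl
  let b : GroupLike k H ⊕ (Σ v, Fin (d v) × Fin (d v)) → H :=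
    Sum.elim GroupLike.val fun i => m i.1 i.2.1 i.2.2
  have hle : ∀ i : Σ v, Fin (d v) × Fin (d v), m i.1 i.2.1 i.2.2 ∈ U i.1 := fun i => by
    rw [hspan]
    exact Submodule.subset_span ⟨i.2, rfl⟩
  have hindepU : iSupIndep U := hindep.comp (Option.some_injective V)
  have hb : LinearIndependent k b := by
    refine LinearIndependent.sum_type linearIndep_groupLikeVal ?_ ?_
    · refine linearIndependent_iUnion_finite (f := fun v (q : Fin (d v) × Fin (d v)) =>
        m v q.1 q.2) hli fun v T _ hv => ?_
      simp only [← hspan]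
      exact (hindepU v).mono_right (iSup₂_le fun w hw =>
        le_iSup₂_of_le (f := fun w (_ : w ≠ v) => U w) w (fun h => hv (h ▸ hw)) le_rfl)
    · rw [range_val_eq_grouplikes]
      refine (hindep none).mono_right (Submodule.span_le.2 ?_)
      rintro _ ⟨i, rfl⟩
      exact (le_iSup₂_of_le (f := fun (j : Option V) (_ : j ≠ none) =>
        j.elim (Submodule.span k (grouplikes k H)) U) (some i.1) (Option.some_ne_none _) le_rfl)
        (hle i)
  have hsurj : Function.Surjective φ := by
    intro X
    obtain ⟨f, hf⟩ := exists_linearMap_apply_eq hb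
      (Sum.elim (fun g => X (Sum.inl g) (0 : Fin 1) (0 : Fin 1))
        fun i => X (Sum.inr i.1) i.2.1 i.2.2)
    refine ⟨WithConv.toConv f, ?_⟩
    funext S
    ext i j
    rw [hφ]
    rcases S with g | v
    · have hi : i = (0 : Fin 1) := Subsingleton.elim (α := Fin 1) i 0
      have hj : j = (0 : Fin 1) := Subsingleton.elim (α := Fin 1) j 0
      rw [hi, hj]
      exact hf (Sum.inl g)
    · exact hf (Sum.inr ⟨v, i, j⟩)
  have hnil : ∀ a, φ a = 0 → IsNilpotent a := by
    intro a ha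
    have h1 : ∀ S i j, a.ofConv (mat S i j) = 0 := fun S i j => by
      rw [← hφ, ha]
      rfl
    refine isNilpotent_of_forall_coradical a fun x hx => ?_
    have h2 : coradical k H ≤ LinearMap.ker a.ofConv := by
      rw [hsup, ← range_val_eq_grouplikes]
      refine sup_le (Submodule.span_le.2 ?_) (iSup_le fun v => ?_)
      · rintro _ ⟨g, rfl⟩
        exact h1 (Sum.inl g) (0 : Fin 1) (0 : Fin 1)
      · rw [hspan, Submodule.span_le]
        rintro _ ⟨q, rfl⟩
        exact h1 (Sum.inr v) q.1 q.2
    exact h2 hx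
  obtain ⟨B, hB⟩ := exists_splitAlg φ hsurj hnil
  exact ⟨{ B with
    mat := mat
    isMul := hmat
    φ_apply := fun a S i j => by rw [hB]; exact hφ a S i j
    mat_inl := fun _ _ _ => rfl }⟩

end Assembly

namespace CoradData

variable {k H : Type*} [Field k] [Ring H] [HopfAlgebra k H] [Fintype (GroupLike k H)]
  [DecidableEq (GroupLike k H)] {V : Type*} [Fintype V] [DecidableEq V] {d : V → ℕ}
  [FiniteDimensional k H]

theorem finrank_radical_add (B : CoradData k H d) : Module.finrank k B.radical +
    ∑ S, degrees (GroupLike k H) d S * degrees (GroupLike k H) d S = Module.finrank k H := by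
  have h := LinearMap.finrank_range_add_finrank_ker B.φ.toLinearMap
  rw [LinearMap.range_eq_top.2 B.surj, finrank_top, finrank_convDual, Module.finrank_pi_fintype]
    at h
  simp only [Module.finrank_matrix, Fintype.card_fin, Module.finrank_self, mul_one] at h
  rw [add_comm]
  exact h

theorem card_mul_add_sum_sq_le [CharZero k] [∀ v, NeZero (d v)] (B : CoradData k H d) {n : ℕ}
    (hn : ∀ g, n ≤ B.rk (Sum.inl g)) :
    Fintype.card (GroupLike k H) * n + ∑ v, d v * d v ≤ Module.finrank k H := by
  rw [B.rk_spec.2.2, Fintype.sum_sum_type, ← smul_eq_mul, ← Finset.card_univ, ← Finset.sum_const]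
  exact add_le_add (Finset.sum_le_sum fun g _ => (hn g).trans_eq (mul_one _).symm)
    (Finset.sum_le_sum fun v _ => Nat.mul_le_mul_right _ (B.degrees_le_rk (Sum.inr v)))

theorem false_of_degrees [IsAlgClosed k] [CharZero k] {p s t : ℕ} (hp : p.Prime) (hp3 : 3 ≤ p)
    (hs : 1 ≤ s) (hcard : Fintype.card (GroupLike k H) = p) (hdim : Module.finrank k H = p ^ 3)
    (B : CoradData k H (Sum.elim (fun _ : Fin (s * p) => p - 1) fun _ : Fin t => p)) : False := by
  have : ∀ v, NeZero (Sum.elim (fun _ : Fin (s * p) => p - 1) (fun _ : Fin t => p) v) := by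
    rintro (v | v)
    · exact ⟨by simp only [Sum.elim_inl]; omega⟩
    · exact ⟨by simp only [Sum.elim_inr]; omega⟩
  have hrad := B.finrank_radical_add
  have hsq := hrad
  simp only [Fintype.sum_sum_type, degrees, Sum.elim_inl, Sum.elim_inr, Finset.sum_const,
    Finset.card_univ, Fintype.card_fin, hcard, smul_eq_mul, mul_one, hdim] at hsq
  rw [← add_assoc p] at hsq
  have hq : p - 1 + 1 = p := by omega
  have hv : 0 < s * p := Nat.mul_pos hs hp.pos
  rcases numeric_cases hp3 hs hsq with ⟨rfl, rfl⟩ | ⟨rfl, rfl, hr⟩ | ⟨hr, rfl⟩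
  · have hd : ∀ v, Sum.elim (fun _ : Fin (1 * p) => p - 1) (fun _ : Fin 0 => p) v = p - 1 := by
      rintro (v | v)
      · rfl
      · exact v.elim0
    obtain ⟨v, hv⟩ := B.rk_eq_of_card_eq hd (by omega) (by rwa [hq]) (by omega)
      (by simp; omega) (by rw [hq, hdim])
    exact B.rk_ne_succ v (by rw [hv, hd])
  · have h1 := B.le_rk_inl hp hp3 (by rintro (v | v) <;> simp) hcard hr
    have h3 := B.card_mul_add_sum_sq_le h1
    simp only [Fintype.sum_sum_type, degrees, Sum.elim_inl, Sum.elim_inr, Finset.sum_const,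
      Finset.card_univ, Fintype.card_fin, hcard, smul_eq_mul, hdim] at h3
    have h4 : p * (p - 2) + 2 * p = p * p := by
      rw [mul_comm 2, ← mul_add, Nat.sub_add_cancel (by omega)]
    omega
  · have hd : ∀ v, Sum.elim (fun _ : Fin (s * p) => p - 1) (fun _ : Fin 0 => p) v = p - 1 := by
      rintro (v | v)
      · rfl
      · exact v.elim0
    refine B.finrank_ne_sum_degrees_sq hd (by omega) (by omega) (Sum.inl ⟨0, hv⟩) ?_
    rw [← hrad, hr, zero_add]

end CoradData

end HopfClass

open HopfClass in
/-- Let `p` be an odd prime and `H` a nonsemisimple, nonpointed, non-copointed Hopf algebra of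
dimension `p³` with `G(H) ≅ C_p`. Then the coradical `H₀` is not isomorphic as a coalgebra to
`kC_p ⊕ M*(p−1,k)^{sp} ⊕ E`, where `s ≥ 1` and `E` is either `0` or `M*(p,k)^t` with `t ≥ 1`
(here `t = 0` encodes `E = 0`). -/
theorem coradical_ne_group_plus_matrix_p_sub_one_copies
    (k : Type*) [Field k] [IsAlgClosed k] [CharZero k]
    (H : Type*) [Ring H] [HopfAlgebra k H] [FiniteDimensional k H]
    (p : ℕ) (hp : p.Prime) (hodd : Odd p)
    (hdim : Module.finrank k H = p ^ 3)
    (hnss : ¬ IsSemisimpleRing H) (hnp : ¬ IsPointed k H) (hncop : ¬ IsCopointed k H)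
    (hG : (grouplikes k H).ncard = p)
    (s t : ℕ) (hs : 1 ≤ s)
    (C : Fin (s * p) → Submodule k H) (D : Fin t → Submodule k H)
    (hC : ∀ i, IsMatrixSubcoalg k H (p - 1) (C i))
    (hD : ∀ j, IsMatrixSubcoalg k H p (D j))
    (hindep : iSupIndep (fun i : Option (Fin (s * p) ⊕ Fin t) =>
      i.elim (Submodule.span k (grouplikes k H)) (Sum.elim C D)))
    (hsup : coradical k H =
      Submodule.span k (grouplikes k H) ⊔ (⨆ i, C i) ⊔ ⨆ j, D j) :
    False := by
  classical
  rw [← range_val_eq_grouplikes, Set.ncard_range_of_injective GroupLike.val_injective] at hG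
  have : Finite (GroupLike k H) := Nat.finite_of_card_ne_zero (hG ▸ hp.ne_zero)
  have : Fintype (GroupLike k H) := Fintype.ofFinite _
  obtain ⟨B⟩ := exists_coradData (U := Sum.elim C D)
    (d := Sum.elim (fun _ : Fin (s * p) => p - 1) fun _ : Fin t => p)
    (by rintro (v | v) <;> simp [hC, hD]) hindep (by rw [hsup, iSup_sum, sup_assoc]; rfl)
  have hp2 : p ≠ 2 := by
    rintro rfl
    exact absurd hodd (by decide)
  refine B.false_of_degrees hp (by have := hp.two_le; omega) hs ?_ hdim
  rw [← hG, Nat.card_eq_fintype_card]
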